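/- arXiv:1103.0341 — 2 statements merged into one kernel-verified Lean document; each statement's English description precedes it below -/
import Mathlib

section
/- Let f, g, h : ℝ → ℝ be infinitely differentiable and set X = f(B), Y = g(B), Z = h(B). For each n define the step process M_n(t) = ∑_{j=1}^{⌊nt⌋} ((X(t_{j−1}) + X(t_j))/2)(Y(t_j) − Y(t_{j−1})), so that δ_j(M_n) = M_n(t_j) − M_n(t_{j−1}). Then for every T > 0, sup_{0 ≤ t ≤ T} | ∑_{j=1}^{⌊nt⌋} ((Z(t_{j−1}) + Z(t_j))/2) δ_j(M_n) − ∑_{j=1}^{⌊nt⌋} ((Z(t_{j−1})X(t_{j−1}) + Z(t_j)X(t_j))/2)(Y(t_j) − Y(t_{j−1})) + (1/4) ∑_{j=1}^{⌊nt⌋} (f' g' h')(β_{j,n}) (ΔB_{j,n})³ | → 0 in probability as n → ∞. (This is the substitution rule: if dM = X dY then Z dM = ZX dY − (1/4)(f'g'h')(B) d⟦B⟧, at the level of Riemann-sum representatives.) -/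
open MeasureTheory ProbabilityTheory Filter Topology

noncomputable section

/-- `B` is a fractional Brownian motion with Hurst parameter `1/6`: a centered Gaussian
process with continuous sample paths and covariance
`E[B s * B t] = (t^(1/3) + s^(1/3) - |t - s|^(1/3)) / 2` for `s, t ≥ 0`. -/
def IsFBM16 {Ω : Type*} [MeasureSpace Ω] (B : ℝ → Ω → ℝ) : Prop :=
  (∀ t : ℝ, Measurable (B t)) ∧
  (∀ ω : Ω, Continuous fun t : ℝ => B t ω) ∧
  (∀ (m : ℕ) (t : Fin m → ℝ) (c : Fin m → ℝ), (∀ i, 0 ≤ t i) →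
    ∃ v : NNReal,
      Measure.map (fun ω => ∑ i, c i * B (t i) ω) (volume : Measure Ω) = gaussianReal 0 v) ∧
  (∀ s t : ℝ, 0 ≤ s → 0 ≤ t →
    ∫ ω, B s ω * B t ω =
      (t ^ ((1 : ℝ) / 3) + s ^ ((1 : ℝ) / 3) - |t - s| ^ ((1 : ℝ) / 3)) / 2)

/-- Integration by parts for a one-dimensional centered Gaussian measure. -/
theorem integral_id_mul_gaussianReal {v : NNReal} (hv : v ≠ 0) {F F' : ℝ → ℝ}
    (hF : ∀ x, HasDerivAt F (F' x) x) (hi : Integrable F (gaussianReal 0 v))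
    (hxi : Integrable (fun x => x * F x) (gaussianReal 0 v))
    (hi' : Integrable F' (gaussianReal 0 v)) :
    ∫ x, x * F x ∂gaussianReal 0 v = v * ∫ x, F' x ∂gaussianReal 0 v := by
  have hv' : (v : ℝ) ≠ 0 := by exact_mod_cast hv
  have key : ∀ {G : ℝ → ℝ}, Integrable G (gaussianReal 0 v) →
      Integrable fun x => gaussianPDFReal 0 v x * G x := by
    intro G hG
    rw [gaussianReal_of_var_ne_zero 0 hv, integrable_withDensity_iff_integrable_smul'
      (measurable_gaussianPDF 0 v) (ae_of_all _ fun x => gaussianPDF_lt_top)] at hG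
    simpa using hG
  have hpdf : ∀ x, HasDerivAt (gaussianPDFReal 0 v) (-(x / v) * gaussianPDFReal 0 v x) x := by
    intro x
    have h1 : HasDerivAt (fun x : ℝ => -(x - 0) ^ 2 / (2 * (v : ℝ))) (-(x / v)) x := by
      have := ((((hasDerivAt_id' x).sub_const 0).fun_pow 2).fun_neg).div_const (2 * (v : ℝ))
      refine this.congr_deriv ?_
      norm_num
      field_simp
    have := (h1.exp).const_mul (Real.sqrt (2 * Real.pi * v))⁻¹
    rw [gaussianPDFReal_def]
    refine this.congr_deriv ?_
    simp only [sub_zero]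
    ring
  have h := integral_mul_deriv_eq_deriv_mul_of_integrable (u := F) (u' := F')
    (v := gaussianPDFReal 0 v) (v' := fun x => -(x / v) * gaussianPDFReal 0 v x)
    (fun x _ => hF x) (fun x _ => hpdf x)
    (by
      refine ((key hxi).const_mul (-(1 / (v : ℝ)))).congr (ae_of_all _ fun x => ?_)
      simp only [Pi.mul_apply]
      ring)
    ((key hi').congr (ae_of_all _ fun x => by simp [mul_comm]))
    ((key hi).congr (ae_of_all _ fun x => by simp [mul_comm]))
  rw [integral_gaussianReal_eq_integral_smul hv, integral_gaussianReal_eq_integral_smul hv]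
  simp only [smul_eq_mul]
  have e1 : ∫ x, gaussianPDFReal 0 v x * F' x = ∫ x, F' x * gaussianPDFReal 0 v x := by
    simp only [mul_comm]
  have e2 : ∫ x, gaussianPDFReal 0 v x * (x * F x) =
      -(v : ℝ) * ∫ x, F x * (-(x / v) * gaussianPDFReal 0 v x) := by
    rw [← integral_const_mul]
    congr 1; ext x; field_simp
  rw [e1, e2, h]; ring

/-- Gaussian integration by parts along the direction `a` of the covariances with one coordinate. -/
theorem integral_mul_comp_of_hasGaussianLaw {Ω ι : Type*} [MeasurableSpace Ω] [Finite ι]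
    {P : Measure Ω} {W : ι → Ω → ℝ} (hW : HasGaussianLaw (fun ω i => W i ω) P)
    (hWm : ∀ i, Measurable (W i))
    (h0 : ∀ i, ∫ ω, W i ω ∂P = 0) (k : ι) {v : ℝ} (hv : 0 < v)
    (hvar : ∫ ω, W k ω * W k ω ∂P = v) (a : ι → ℝ)
    (ha : ∀ i, ∫ ω, W k ω * W i ω ∂P = v * a i)
    {Φ D : (ι → ℝ) → ℝ} (hΦm : Measurable Φ) (hDm : Measurable D)
    (hΦ : ∀ x s, HasDerivAt (fun s : ℝ => Φ (x + s • a)) (D (x + s • a)) s)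
    (hi : Integrable (fun ω => Φ (fun i => W i ω)) P)
    (hxi : Integrable (fun ω => W k ω * Φ (fun i => W i ω)) P)
    (hi' : Integrable (fun ω => D (fun i => W i ω)) P) :
    ∫ ω, W k ω * Φ (fun i => W i ω) ∂P = v * ∫ ω, D (fun i => W i ω) ∂P := by
  have := Fintype.ofFinite ι
  have hP := hW.isProbabilityMeasure
  have hmem : ∀ i, MemLp (W i) 2 P := fun i => (hW.eval i).memLp_two
  set η : ι → Ω → ℝ := fun i ω => W i ω - W k ω * a i with hη
  have hηm : ∀ i, Measurable (η i) := fun i => (hWm i).sub ((hWm k).mul_const _)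
  have hlaw : P.map (W k) = gaussianReal 0 v.toNNReal := by
    rw [(hW.eval k).map_eq_gaussianReal, h0 k]
    rw [variance_of_integral_eq_zero (hWm k).aemeasurable (h0 k)]
    congr 2
    rw [← hvar]
    simp [pow_two]
  have hjoint : HasGaussianLaw (fun ω => ((fun _ : Unit => W k ω), fun i => η i ω)) P := by
    have := hW.map_fun ((ContinuousLinearMap.pi fun _ : Unit =>
      (ContinuousLinearMap.proj k : (ι → ℝ) →L[ℝ] ℝ)).prod
      (ContinuousLinearMap.pi fun i : ι => (ContinuousLinearMap.proj i : (ι → ℝ) →L[ℝ] ℝ) -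
        (a i) • (ContinuousLinearMap.proj k : (ι → ℝ) →L[ℝ] ℝ)))
    refine this.congr (ae_of_all _ fun ω => ?_)
    ext i
    · simp
    · simp [hη, mul_comm]
  have hind' := hjoint.indepFun_of_covariance_eval (X := fun _ : Unit => W k) (Y := η) (by
    intro _ i
    have h0η : ∫ ω, η i ω ∂P = 0 := by
      rw [hη, integral_sub ((hmem i).integrable one_le_two)
        (((hmem k).integrable one_le_two).mul_const _), integral_mul_const, h0, h0]
      simp
    rw [covariance, h0 k, h0η]
    simp only [sub_zero, hη]
    have e : ∀ ω, W k ω * (W i ω - W k ω * a i) = W k ω * W i ω - (W k ω * W k ω) * a i := by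
      intro ω; ring
    simp only [e]
    have i1 : Integrable (fun ω => W k ω * W i ω) P := (hmem k).integrable_mul (hmem i)
    have i2 : Integrable (fun ω => W k ω * W k ω) P := (hmem k).integrable_mul (hmem k)
    rw [integral_sub i1 (i2.mul_const _), integral_mul_const, hvar, ha]
    ring)
  have hind : IndepFun (W k) (fun ω i => η i ω) P :=
    hind'.comp (φ := fun x : Unit → ℝ => x ()) (ψ := id) (by fun_prop) measurable_id
  have hηm' : Measurable fun ω i => η i ω := measurable_pi_lambda _ hηm
  have hprod := (indepFun_iff_map_prod_eq_prod_map_map (hWm k).aemeasurable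
    hηm'.aemeasurable).1 hind
  rw [hlaw] at hprod
  set ν := P.map fun ω i => η i ω
  have : IsProbabilityMeasure ν := Measure.isProbabilityMeasure_map hηm'.aemeasurable
  have hpm : Measurable fun ω => (W k ω, fun i => η i ω) := (hWm k).prodMk hηm'
  have hrec : ∀ ω, (fun i => W i ω) = (fun i => η i ω) + W k ω • a := by
    intro ω; ext i; simp [hη]
  have hsm : Measurable fun p : ℝ × (ι → ℝ) => p.2 + p.1 • a := by fun_prop
  have tr : ∀ {G : ℝ × (ι → ℝ) → ℝ}, Measurable G →
      Integrable (fun ω => G (W k ω, fun i => η i ω)) P →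
      Integrable G ((gaussianReal 0 v.toNNReal).prod ν) ∧
      ∫ ω, G (W k ω, fun i => η i ω) ∂P =
        ∫ y, ∫ x, G (x, y) ∂gaussianReal 0 v.toNNReal ∂ν := by
    intro G hG hint
    have h1 : Integrable G ((gaussianReal 0 v.toNNReal).prod ν) := by
      rw [← hprod]
      exact (integrable_map_measure hG.aestronglyMeasurable hpm.aemeasurable).2 hint
    refine ⟨h1, ?_⟩
    rw [← integral_prod_symm _ h1, ← hprod,
      integral_map hpm.aemeasurable hG.aestronglyMeasurable]
  simp only [hrec] at hi hxi hi' ⊢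
  obtain ⟨i1, -⟩ := tr (G := fun p => Φ (p.2 + p.1 • a)) (hΦm.comp hsm) hi
  obtain ⟨i2, e2⟩ := tr (G := fun p => p.1 * Φ (p.2 + p.1 • a))
    (measurable_fst.mul (hΦm.comp hsm)) hxi
  obtain ⟨i3, e3⟩ := tr (G := fun p => D (p.2 + p.1 • a)) (hDm.comp hsm) hi'
  simp only at e2 e3
  rw [e2, e3, ← integral_const_mul]
  refine integral_congr_ae ?_
  filter_upwards [i1.prod_left_ae, i2.prod_left_ae, i3.prod_left_ae] with y h1 h2 h3
  have := integral_id_mul_gaussianReal (v := v.toNNReal) (by simpa using hv) (hΦ y) h1 h2 h3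
  rwa [Real.coe_toNNReal _ hv.le] at this

/-- The absolute moments of the standard Gaussian distribution. -/
def gaussianAbsMoment (p : ℕ) : ℝ := ∫ x, |x| ^ p ∂gaussianReal 0 1

theorem gaussianAbsMoment_nonneg (p : ℕ) : 0 ≤ gaussianAbsMoment p :=
  integral_nonneg fun _ => by positivity

theorem integrable_abs_pow_of_map_eq {Ω : Type*} [MeasurableSpace Ω] {P : Measure Ω} {U : Ω → ℝ}
    (hU : Measurable U) {v : NNReal} (hlaw : P.map U = gaussianReal 0 v) (p : ℕ) :
    Integrable (fun ω => |U ω| ^ p) P := by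
  have h : Integrable (fun x : ℝ => |x| ^ p) (gaussianReal 0 v) := by
    rcases Nat.eq_zero_or_pos p with rfl | hp
    · simp
    · have := (memLp_id_gaussianReal' (μ := 0) (v := v) p (by simp)).integrable_norm_pow
        (by omega)
      simpa using this
  rw [← hlaw] at h
  exact (integrable_map_measure (by fun_prop) hU.aemeasurable).1 h

theorem integral_abs_pow_of_map_eq {Ω : Type*} [MeasurableSpace Ω] {P : Measure Ω} {U : Ω → ℝ}
    (hU : Measurable U) {s : ℝ} (hs : 0 ≤ s)
    (hlaw : P.map U = gaussianReal 0 (s ^ 2).toNNReal) (p : ℕ) :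
    ∫ ω, |U ω| ^ p ∂P = s ^ p * gaussianAbsMoment p := by
  have h1 : (gaussianReal 0 1).map (s * ·) = gaussianReal 0 (s ^ 2).toNNReal := by
    rw [gaussianReal_map_const_mul]
    congr 1
    · simp
    · ext; simp [Real.coe_toNNReal _ (sq_nonneg s)]
  have h2 : ∫ ω, |U ω| ^ p ∂P = ∫ x, |x| ^ p ∂P.map U :=
    (integral_map hU.aemeasurable (f := fun x : ℝ => |x| ^ p) (by fun_prop)).symm
  rw [h2, hlaw, ← h1, integral_map (by fun_prop) (by fun_prop), gaussianAbsMoment,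
    ← integral_const_mul]
  congr 1; ext x
  rw [abs_mul, mul_pow, abs_of_nonneg hs]

/-- Bound on mixed moments of two Gaussian variables with the same variance. -/
theorem abs_integral_mul_pow_mul_pow_le {Ω : Type*} [MeasurableSpace Ω] {P : Measure Ω}
    {U V G : Ω → ℝ} (hU : Measurable U) (hV : Measurable V) (hG : Measurable G) {s c : ℝ}
    (hs : 0 ≤ s) (hUl : P.map U = gaussianReal 0 (s ^ 2).toNNReal)
    (hVl : P.map V = gaussianReal 0 (s ^ 2).toNNReal) (hGc : ∀ ω, |G ω| ≤ c) (a b : ℕ) :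
    Integrable (fun ω => G ω * U ω ^ a * V ω ^ b) P ∧
      |∫ ω, G ω * U ω ^ a * V ω ^ b ∂P| ≤ c * (2 * s ^ (a + b) * gaussianAbsMoment (a + b)) := by
  have hb : ∀ ω, ‖G ω * U ω ^ a * V ω ^ b‖ ≤ c * (|U ω| ^ (a + b) + |V ω| ^ (a + b)) := by
    intro ω
    rw [Real.norm_eq_abs, abs_mul, abs_mul, abs_pow, abs_pow, mul_assoc]
    refine mul_le_mul (hGc ω) ?_ (by positivity) ((abs_nonneg _).trans (hGc ω))
    rw [pow_add, pow_add]
    rcases le_total |U ω| |V ω| with h | h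
    · have := mul_le_mul_of_nonneg_right (pow_le_pow_left₀ (abs_nonneg _) h a)
        (pow_nonneg (abs_nonneg (V ω)) b)
      have : 0 ≤ |U ω| ^ a * |U ω| ^ b := by positivity
      linarith
    · have := mul_le_mul_of_nonneg_left (pow_le_pow_left₀ (abs_nonneg _) h b)
        (pow_nonneg (abs_nonneg (U ω)) a)
      have : 0 ≤ |V ω| ^ a * |V ω| ^ b := by positivity
      linarith
  have i1 := integrable_abs_pow_of_map_eq hU hUl (a + b)
  have i2 := integrable_abs_pow_of_map_eq hV hVl (a + b)
  have i3 : Integrable (fun ω => c * (|U ω| ^ (a + b) + |V ω| ^ (a + b))) P :=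
    (i1.add i2).const_mul c
  have hm : Measurable fun ω => G ω * U ω ^ a * V ω ^ b := by fun_prop
  refine ⟨i3.mono' hm.aestronglyMeasurable (ae_of_all _ hb), ?_⟩
  refine (norm_integral_le_of_norm_le i3 (ae_of_all _ hb)).trans_eq ?_
  rw [integral_const_mul, integral_add i1 i2, integral_abs_pow_of_map_eq hU hs hUl,
    integral_abs_pow_of_map_eq hV hs hVl]
  ring

/-- Correlation estimate for weighted fifth powers of Gaussian variables, in terms of the
covariances of the first variable with the others. -/
theorem abs_integral_weighted_fifth_powers_le {Ω : Type*} [MeasurableSpace Ω] {P : Measure Ω}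
    {W : Fin 4 → Ω → ℝ} (hW : HasGaussianLaw (fun ω i => W i ω) P)
    (hWm : ∀ i, Measurable (W i)) (h0 : ∀ i, ∫ ω, W i ω ∂P = 0) {s : ℝ} (hs : 0 < s)
    (hs1 : s ≤ 1) (hv0 : ∫ ω, W 0 ω * W 0 ω ∂P = s ^ 2) (hv3 : ∫ ω, W 3 ω * W 3 ω ∂P = s ^ 2)
    {φ φ' : ℝ → ℝ} (hφ : ∀ x, HasDerivAt φ (φ' x) x) (hφ'm : Measurable φ') {K m : ℝ}
    (hK : ∀ x, |φ x| ≤ K) (hK' : ∀ x, |φ' x| ≤ K) (hm : ∀ p ≤ 10, gaussianAbsMoment p ≤ m) :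
    |∫ ω, φ (W 1 ω) * W 0 ω ^ 5 * (φ (W 2 ω) * W 3 ω ^ 5) ∂P| ≤
      130 * K ^ 2 * m * s ^ 8 * (|∫ ω, W 0 ω * W 1 ω ∂P| + |∫ ω, W 0 ω * W 2 ω ∂P| +
        |∫ ω, W 0 ω * W 3 ω ∂P|) := by
  have hK0 : 0 ≤ K := (abs_nonneg _).trans (hK 0)
  have hm0 : 0 ≤ m := (gaussianAbsMoment_nonneg 0).trans (hm 0 (by norm_num))
  have hφm : Measurable φ := (continuous_iff_continuousAt.2 fun x => (hφ x).continuousAt).measurable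
  have hlaw : ∀ i, ∫ ω, W i ω * W i ω ∂P = s ^ 2 →
      P.map (W i) = gaussianReal 0 (s ^ 2).toNNReal := by
    intro i hi
    rw [(hW.eval i).map_eq_gaussianReal, h0 i,
      variance_of_integral_eq_zero (hWm i).aemeasurable (h0 i), ← hi]
    simp [pow_two]
  have hl0 := hlaw 0 hv0
  have hl3 := hlaw 3 hv3
  have mom : ∀ {G : Ω → ℝ}, Measurable G → (∀ ω, |G ω| ≤ K ^ 2) → ∀ a b, a + b ≤ 10 →
      Integrable (fun ω => G ω * W 0 ω ^ a * W 3 ω ^ b) P ∧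
      |∫ ω, G ω * W 0 ω ^ a * W 3 ω ^ b ∂P| ≤ 2 * K ^ 2 * m * s ^ (a + b) := by
    intro G hG hGK a b hab
    obtain ⟨h1, h2⟩ := abs_integral_mul_pow_mul_pow_le (hWm 0) (hWm 3) hG hs.le hl0 hl3 hGK a b
    refine ⟨h1, h2.trans ?_⟩
    have := mul_le_mul_of_nonneg_left (hm _ hab) (by positivity : 0 ≤ 2 * K ^ 2 * s ^ (a + b))
    linarith
  have hKK : ∀ {x y : ℝ}, |x| ≤ K → |y| ≤ K → |x * y| ≤ K ^ 2 := by
    intro x y hx hy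
    rw [abs_mul, pow_two]
    exact mul_le_mul hx hy (abs_nonneg _) hK0
  have m1 := hWm 1
  have m2 := hWm 2
  set J : ℕ → ℝ := fun k => ∫ ω, (φ (W 1 ω) * φ (W 2 ω)) * W 0 ω ^ k * W 3 ω ^ 5 ∂P with hJ
  set c1 := ∫ ω, W 0 ω * W 1 ω ∂P with hc1
  set c2 := ∫ ω, W 0 ω * W 2 ω ∂P with hc2
  set c3 := ∫ ω, W 0 ω * W 3 ω ∂P with hc3
  have hG00 : Measurable fun ω => φ (W 1 ω) * φ (W 2 ω) := by fun_prop
  have hG10 : Measurable fun ω => φ' (W 1 ω) * φ (W 2 ω) := by fun_prop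
  have hG01 : Measurable fun ω => φ (W 1 ω) * φ' (W 2 ω) := by fun_prop
  have b00 : ∀ ω, |φ (W 1 ω) * φ (W 2 ω)| ≤ K ^ 2 := fun ω => hKK (hK _) (hK _)
  have b10 : ∀ ω, |φ' (W 1 ω) * φ (W 2 ω)| ≤ K ^ 2 := fun ω => hKK (hK' _) (hK _)
  have b01 : ∀ ω, |φ (W 1 ω) * φ' (W 2 ω)| ≤ K ^ 2 := fun ω => hKK (hK _) (hK' _)
  have hstep : ∀ k ≤ 4, |J (k + 1)| ≤ k * s ^ 2 * |J (k - 1)| +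
      10 * K ^ 2 * m * s ^ (k + 4) * (|c1| + |c2| + |c3|) := by
    intro k hk
    obtain ⟨i1, e1⟩ := mom hG00 b00 (k - 1) 5 (by omega)
    obtain ⟨i2, e2⟩ := mom hG10 b10 k 5 (by omega)
    obtain ⟨i3, e3⟩ := mom hG01 b01 k 5 (by omega)
    obtain ⟨i4, e4⟩ := mom hG00 b00 k 4 (by omega)
    have i0 := (mom hG00 b00 k 5 (by omega)).1
    have j1 := i1.const_mul (k : ℝ)
    have j2 := i2.const_mul (c1 / s ^ 2)
    have j3 := i3.const_mul (c2 / s ^ 2)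
    have j4 := i4.const_mul (5 * (c3 / s ^ 2))
    have hst := integral_mul_comp_of_hasGaussianLaw hW hWm h0 0 (v := s ^ 2) (by positivity) hv0
      (fun i => (∫ ω, W 0 ω * W i ω ∂P) / s ^ 2) (fun i => by field_simp)
      (Φ := fun x => (φ (x 1) * φ (x 2)) * x 0 ^ k * x 3 ^ 5)
      (D := fun x => k * ((φ (x 1) * φ (x 2)) * x 0 ^ (k - 1) * x 3 ^ 5) +
        c1 / s ^ 2 * ((φ' (x 1) * φ (x 2)) * x 0 ^ k * x 3 ^ 5) +
        c2 / s ^ 2 * ((φ (x 1) * φ' (x 2)) * x 0 ^ k * x 3 ^ 5) +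
        5 * (c3 / s ^ 2) * ((φ (x 1) * φ (x 2)) * x 0 ^ k * x 3 ^ 4))
      (by fun_prop) (by fun_prop)
      (by
        intro x t
        have hlin : ∀ i : Fin 4, HasDerivAt
            (fun t : ℝ => x i + t * ((∫ ω, W 0 ω * W i ω ∂P) / s ^ 2))
            ((∫ ω, W 0 ω * W i ω ∂P) / s ^ 2) t := by
          intro i
          simpa using ((hasDerivAt_id' t).mul_const ((∫ ω, W 0 ω * W i ω ∂P) / s ^ 2)).const_add
            (x i)
        have d1 := (hφ _).comp t (hlin 1)
        have d2 := (hφ _).comp t (hlin 2)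
        have d0 := (hlin 0).fun_pow k
        have d3 := (hlin 3).fun_pow 5
        have := ((d1.fun_mul d2).fun_mul d0).fun_mul d3
        simp only [Pi.add_apply, Pi.smul_apply, smul_eq_mul]
        refine this.congr_deriv ?_
        rw [hv0, ← hc1, ← hc2, ← hc3, div_self (by positivity)]
        simp only [Function.comp_apply]
        norm_num
        ring)
      i0
      (by
        have i5 := (mom hG00 b00 (k + 1) 5 (by omega)).1
        refine i5.congr (ae_of_all _ fun ω => ?_)
        simp only
        ring)
      (((j1.add j2).add j3).add j4)
    have hl : ∫ ω, W 0 ω * (φ (W 1 ω) * φ (W 2 ω) * W 0 ω ^ k * W 3 ω ^ 5) ∂P = J (k + 1) := by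
      rw [hJ]
      congr 1; ext ω; ring
    simp only at hst
    rw [hl, integral_add (by exact (j1.add j2).add j3) j4, integral_add (by exact j1.add j2) j3,
      integral_add j1 j2] at hst
    simp only [integral_const_mul] at hst
    have hst' : J (k + 1) = k * s ^ 2 * J (k - 1) +
        c1 * (∫ ω, (φ' (W 1 ω) * φ (W 2 ω)) * W 0 ω ^ k * W 3 ω ^ 5 ∂P) +
        c2 * (∫ ω, (φ (W 1 ω) * φ' (W 2 ω)) * W 0 ω ^ k * W 3 ω ^ 5 ∂P) +
        5 * c3 * (∫ ω, (φ (W 1 ω) * φ (W 2 ω)) * W 0 ω ^ k * W 3 ω ^ 4 ∂P) := by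
      rw [hst, hJ]
      field_simp
    have hpow : s ^ (k + 5) ≤ s ^ (k + 4) := pow_le_pow_of_le_one hs.le hs1 (by omega)
    have hB : 2 * K ^ 2 * m * s ^ (k + 5) ≤ 2 * K ^ 2 * m * s ^ (k + 4) :=
      mul_le_mul_of_nonneg_left hpow (by positivity)
    set B := 2 * K ^ 2 * m * s ^ (k + 4) with hBdef
    have hB0 : 0 ≤ B := by positivity
    rw [hst']
    refine (abs_add_le _ _).trans ?_
    refine (add_le_add_left (abs_add_le _ _) _).trans ?_
    refine (add_le_add_left (add_le_add_left (abs_add_le _ _) _) _).trans ?_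
    simp only [abs_mul, abs_pow, abs_of_pos hs, Nat.abs_cast]
    have t1 := mul_le_mul_of_nonneg_left (e2.trans hB) (abs_nonneg c1)
    have t2 := mul_le_mul_of_nonneg_left (e3.trans hB) (abs_nonneg c2)
    have t3 := mul_le_mul_of_nonneg_left e4 (abs_nonneg c3)
    have u1 := mul_nonneg (abs_nonneg c1) hB0
    have u2 := mul_nonneg (abs_nonneg c2) hB0
    have h5 : |(5 : ℝ)| = 5 := by norm_num
    rw [h5]
    have : 10 * K ^ 2 * m * s ^ (k + 4) * (|c1| + |c2| + |c3|) =
      5 * (|c1| * B) + 5 * (|c2| * B) + 5 * (|c3| * B) := by rw [hBdef]; ring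
    linarith
  have r4 := hstep 4 le_rfl
  have r2 := hstep 2 (by norm_num)
  have r0 := hstep 0 (by norm_num)
  norm_num at r4 r2 r0
  have hgoal : ∫ ω, φ (W 1 ω) * W 0 ω ^ 5 * (φ (W 2 ω) * W 3 ω ^ 5) ∂P = J 5 := by
    rw [hJ]
    congr 1; ext ω; ring
  rw [hgoal]
  set θ := |c1| + |c2| + |c3|
  have v2 := mul_le_mul_of_nonneg_left r0 (by positivity : 0 ≤ 2 * s ^ 2)
  have v4 := mul_le_mul_of_nonneg_left (r2.trans (add_le_add_left v2 _))
    (by positivity : 0 ≤ 4 * s ^ 2)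
  refine (r4.trans (add_le_add_left v4 _)).trans_eq ?_
  ring

/-- Centered Gaussian sequence with the covariance of a fractional Brownian motion of
Hurst parameter `1/6` at the integers, scaled by `s`. -/
structure IsScaledFBMGrid {Ω : Type*} [MeasurableSpace Ω] (P : Measure Ω) (s : ℝ)
    (b : ℕ → Ω → ℝ) : Prop where
  measurable : ∀ i, Measurable (b i)
  gaussian : ∀ i j : ℕ,
    HasGaussianLaw (fun ω => ![b i ω, b (i + 1) ω, b j ω, b (j + 1) ω]) P
  mean : ∀ i, ∫ ω, b i ω ∂P = 0
  cov : ∀ i j : ℕ, ∫ ω, b i ω * b j ω ∂P = s ^ 2 *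
    (((j : ℝ) ^ ((1 : ℝ) / 3) + (i : ℝ) ^ ((1 : ℝ) / 3) - |(j : ℝ) - i| ^ ((1 : ℝ) / 3)) / 2)

/-- The increments of a cube-root power of the distance to a point have bounded total variation. -/
theorem sum_abs_cbrt_increment_le {t m : ℕ} (htm : t ≤ m) :
    ∑ i ∈ Finset.range m,
      |((i : ℝ) + 1) ^ ((1 : ℝ) / 3) - (i : ℝ) ^ ((1 : ℝ) / 3) -
        |(t : ℝ) - (i + 1)| ^ ((1 : ℝ) / 3) + |(t : ℝ) - i| ^ ((1 : ℝ) / 3)| ≤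
      3 * (m : ℝ) ^ ((1 : ℝ) / 3) := by
  have hp : (0 : ℝ) ≤ 1 / 3 := by norm_num
  set u : ℕ → ℝ := fun i => (max ((i : ℝ) - t) 0) ^ ((1 : ℝ) / 3) with hu
  set w : ℕ → ℝ := fun i => (max ((t : ℝ) - i) 0) ^ ((1 : ℝ) / 3) with hw
  set r : ℕ → ℝ := fun i => (i : ℝ) ^ ((1 : ℝ) / 3) with hr
  have huw : ∀ i : ℕ, |(t : ℝ) - i| ^ ((1 : ℝ) / 3) = u i + w i := by
    intro i
    rcases le_total (t : ℝ) i with h | h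
    · simp only [hu, hw]
      rw [max_eq_left (by linarith), max_eq_right (by linarith), Real.zero_rpow (by norm_num),
        abs_of_nonpos (by linarith)]
      ring_nf
    · simp only [hu, hw]
      rw [max_eq_right (by linarith), max_eq_left (by linarith), Real.zero_rpow (by norm_num),
        abs_of_nonneg (by linarith)]
      ring_nf
  have hmono : ∀ i, u i ≤ u (i + 1) ∧ w (i + 1) ≤ w i ∧ r i ≤ r (i + 1) := by
    intro i
    refine ⟨Real.rpow_le_rpow (le_max_right _ _) (max_le_max ?_ le_rfl) hp,
      Real.rpow_le_rpow (le_max_right _ _) (max_le_max ?_ le_rfl) hp,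
      Real.rpow_le_rpow (by positivity) ?_ hp⟩ <;> push_cast <;> linarith
  have hterm : ∀ i ∈ Finset.range m,
      |((i : ℝ) + 1) ^ ((1 : ℝ) / 3) - (i : ℝ) ^ ((1 : ℝ) / 3) -
        |(t : ℝ) - (i + 1)| ^ ((1 : ℝ) / 3) + |(t : ℝ) - i| ^ ((1 : ℝ) / 3)| ≤
      (r (i + 1) + u (i + 1) - w (i + 1)) - (r i + u i - w i) := by
    intro i _
    have h1 := huw (i + 1)
    push_cast at h1
    rw [h1, huw i]
    have e1 : ((i : ℝ) + 1) ^ ((1 : ℝ) / 3) = r (i + 1) := by simp [hr]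
    have e2 : (i : ℝ) ^ ((1 : ℝ) / 3) = r i := rfl
    rw [e1, e2, abs_le]
    obtain ⟨a1, a2, a3⟩ := hmono i
    constructor <;> linarith
  refine (Finset.sum_le_sum hterm).trans ?_
  rw [Finset.sum_range_sub (fun i => r i + u i - w i)]
  have t1 : u m ≤ r m := Real.rpow_le_rpow (le_max_right _ _)
    (max_le (by linarith [(Nat.cast_nonneg t : (0 : ℝ) ≤ t)]) (by positivity)) hp
  have htm' : (t : ℝ) ≤ m := by exact_mod_cast htm
  have t2 : w 0 ≤ r m := Real.rpow_le_rpow (le_max_right _ _)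
    (max_le (by push_cast; linarith) (by positivity)) hp
  have t3 : 0 ≤ u 0 := Real.rpow_nonneg (le_max_right _ _) _
  have t4 : 0 ≤ w m := Real.rpow_nonneg (le_max_right _ _) _
  have t5 : 0 ≤ r 0 := Real.rpow_nonneg (by positivity) _
  have e2 : (m : ℝ) ^ ((1 : ℝ) / 3) = r m := rfl
  rw [e2]
  linarith

namespace IsScaledFBMGrid

variable {Ω : Type*} [MeasurableSpace Ω] {P : Measure Ω} {s : ℝ} {b : ℕ → Ω → ℝ}

theorem memLp (hb : IsScaledFBMGrid P s b) (i : ℕ) : MemLp (b i) 2 P :=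
  ((hb.gaussian i i).eval 0).memLp_two

theorem integrable_mul (hb : IsScaledFBMGrid P s b) (i j : ℕ) :
    Integrable (fun ω => b i ω * b j ω) P :=
  (hb.memLp i).integrable_mul (hb.memLp j)

theorem integral_increment_mul (hb : IsScaledFBMGrid P s b) (i t : ℕ) :
    ∫ ω, (b (i + 1) ω - b i ω) * b t ω ∂P = s ^ 2 / 2 *
      (((i : ℝ) + 1) ^ ((1 : ℝ) / 3) - (i : ℝ) ^ ((1 : ℝ) / 3) -
        |(t : ℝ) - (i + 1)| ^ ((1 : ℝ) / 3) + |(t : ℝ) - i| ^ ((1 : ℝ) / 3)) := by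
  simp only [sub_mul]
  rw [integral_sub (hb.integrable_mul _ _) (hb.integrable_mul _ _), hb.cov, hb.cov]
  push_cast
  ring

theorem integrable_increment_mul (hb : IsScaledFBMGrid P s b) (i t : ℕ) :
    Integrable (fun ω => (b (i + 1) ω - b i ω) * b t ω) P := by
  simp only [sub_mul]
  exact (hb.integrable_mul _ _).sub (hb.integrable_mul _ _)

theorem sum_abs_integral_increment_mul_le (hb : IsScaledFBMGrid P s b) {t m : ℕ} (htm : t ≤ m) :
    ∑ i ∈ Finset.range m, |∫ ω, (b (i + 1) ω - b i ω) * b t ω ∂P| ≤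
      3 / 2 * s ^ 2 * (m : ℝ) ^ ((1 : ℝ) / 3) := by
  simp only [hb.integral_increment_mul, abs_mul, abs_of_nonneg (by positivity : 0 ≤ s ^ 2 / 2)]
  rw [← Finset.mul_sum]
  have := mul_le_mul_of_nonneg_left (sum_abs_cbrt_increment_le htm)
    (by positivity : 0 ≤ s ^ 2 / 2)
  linarith

theorem sum_abs_integral_increment_mul_midpoint_le (hb : IsScaledFBMGrid P s b) {j m : ℕ}
    (hjm : j < m) :
    ∑ i ∈ Finset.range m, |∫ ω, (b (i + 1) ω - b i ω) * ((b j ω + b (j + 1) ω) / 2) ∂P| ≤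
      3 / 2 * s ^ 2 * (m : ℝ) ^ ((1 : ℝ) / 3) := by
  have h : ∀ i ∈ Finset.range m,
      |∫ ω, (b (i + 1) ω - b i ω) * ((b j ω + b (j + 1) ω) / 2) ∂P| ≤
      (|∫ ω, (b (i + 1) ω - b i ω) * b j ω ∂P| +
        |∫ ω, (b (i + 1) ω - b i ω) * b (j + 1) ω ∂P|) / 2 := by
    intro i _
    have e : ∀ ω, (b (i + 1) ω - b i ω) * ((b j ω + b (j + 1) ω) / 2) =
      ((b (i + 1) ω - b i ω) * b j ω + (b (i + 1) ω - b i ω) * b (j + 1) ω) / 2 := by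
      intro ω; ring
    simp only [e]
    rw [integral_div, integral_add (hb.integrable_increment_mul _ _)
      (hb.integrable_increment_mul _ _), abs_div, abs_two]
    gcongr
    exact abs_add_le _ _
  refine (Finset.sum_le_sum h).trans ?_
  rw [← Finset.sum_div, Finset.sum_add_distrib]
  linarith [hb.sum_abs_integral_increment_mul_le hjm.le, hb.sum_abs_integral_increment_mul_le hjm]

theorem sum_abs_integral_increment_mul_increment_le (hb : IsScaledFBMGrid P s b) {j m : ℕ}
    (hjm : j < m) :
    ∑ i ∈ Finset.range m, |∫ ω, (b (i + 1) ω - b i ω) * (b (j + 1) ω - b j ω) ∂P| ≤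
      3 * s ^ 2 * (m : ℝ) ^ ((1 : ℝ) / 3) := by
  have h : ∀ i ∈ Finset.range m,
      |∫ ω, (b (i + 1) ω - b i ω) * (b (j + 1) ω - b j ω) ∂P| ≤
      |∫ ω, (b (i + 1) ω - b i ω) * b (j + 1) ω ∂P| +
        |∫ ω, (b (i + 1) ω - b i ω) * b j ω ∂P| := by
    intro i _
    simp only [mul_sub]
    rw [integral_sub (hb.integrable_increment_mul _ _) (hb.integrable_increment_mul _ _)]
    exact abs_sub _ _
  refine (Finset.sum_le_sum h).trans ?_
  rw [Finset.sum_add_distrib]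
  linarith [hb.sum_abs_integral_increment_mul_le hjm.le, hb.sum_abs_integral_increment_mul_le hjm]

theorem sum_abs_integral_increment_mul_self_midpoint (hb : IsScaledFBMGrid P s b) (m : ℕ) :
    ∑ i ∈ Finset.range m, |∫ ω, (b (i + 1) ω - b i ω) * ((b i ω + b (i + 1) ω) / 2) ∂P| =
      s ^ 2 / 2 * (m : ℝ) ^ ((1 : ℝ) / 3) := by
  have h : ∀ i ∈ Finset.range m,
      |∫ ω, (b (i + 1) ω - b i ω) * ((b i ω + b (i + 1) ω) / 2) ∂P| =
      s ^ 2 / 2 * ((i + 1 : ℕ) : ℝ) ^ ((1 : ℝ) / 3) - s ^ 2 / 2 * (i : ℝ) ^ ((1 : ℝ) / 3) := by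
    intro i _
    have e : ∀ ω, (b (i + 1) ω - b i ω) * ((b i ω + b (i + 1) ω) / 2) =
      (b (i + 1) ω * b (i + 1) ω - b i ω * b i ω) / 2 := by
      intro ω; ring
    simp only [e]
    rw [integral_div, integral_sub (hb.integrable_mul _ _) (hb.integrable_mul _ _), hb.cov, hb.cov]
    have hle : (i : ℝ) ^ ((1 : ℝ) / 3) ≤ ((i + 1 : ℕ) : ℝ) ^ ((1 : ℝ) / 3) :=
      Real.rpow_le_rpow (by positivity) (by push_cast; linarith) (by norm_num)
    have := mul_le_mul_of_nonneg_left hle (by positivity : 0 ≤ s ^ 2 / 2)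
    rw [sub_self, sub_self, abs_zero, Real.zero_rpow (by norm_num), abs_of_nonneg] <;> linarith
  rw [Finset.sum_congr rfl h, Finset.sum_range_sub (fun i : ℕ => s ^ 2 / 2 * (i : ℝ) ^ ((1 : ℝ) / 3))]
  norm_num

theorem map_increment (hb : IsScaledFBMGrid P s b) (i : ℕ) :
    P.map (fun ω => b (i + 1) ω - b i ω) = gaussianReal 0 (s ^ 2).toNNReal := by
  have hg : HasGaussianLaw (fun ω => b (i + 1) ω - b i ω) P := by
    have := (hb.gaussian i i).map_fun ((ContinuousLinearMap.proj 1 : (Fin 4 → ℝ) →L[ℝ] ℝ) -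
      ContinuousLinearMap.proj 0)
    refine this.congr (ae_of_all _ fun ω => ?_)
    simp
  have hm : Measurable fun ω => b (i + 1) ω - b i ω :=
    (hb.measurable _).sub (hb.measurable _)
  have := hg.isProbabilityMeasure
  have h0 : ∫ ω, b (i + 1) ω - b i ω ∂P = 0 := by
    rw [integral_sub ((hb.memLp _).integrable one_le_two) ((hb.memLp _).integrable one_le_two),
      hb.mean, hb.mean, sub_zero]
  rw [hg.map_eq_gaussianReal, h0, variance_of_integral_eq_zero hm.aemeasurable h0]
  congr 2
  have e : ∀ ω, (b (i + 1) ω - b i ω) ^ 2 =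
      (b (i + 1) ω - b i ω) * b (i + 1) ω - (b (i + 1) ω - b i ω) * b i ω := by
    intro ω; ring
  simp only [e]
  rw [integral_sub (hb.integrable_increment_mul _ _) (hb.integrable_increment_mul _ _),
    hb.integral_increment_mul, hb.integral_increment_mul]
  push_cast
  norm_num
  ring

theorem integral_increment_sq (hb : IsScaledFBMGrid P s b) (i : ℕ) :
    ∫ ω, (b (i + 1) ω - b i ω) * (b (i + 1) ω - b i ω) ∂P = s ^ 2 := by
  simp only [mul_sub]
  rw [integral_sub (hb.integrable_increment_mul _ _) (hb.integrable_increment_mul _ _),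
    hb.integral_increment_mul, hb.integral_increment_mul]
  push_cast
  norm_num
  ring

/-- Second moment of the sums of weighted fifth powers of the increments. -/
theorem integral_sq_sum_weighted_fifth_powers_le (hb : IsScaledFBMGrid P s b) (hs : 0 < s)
    (hs1 : s ≤ 1) {φ φ' : ℝ → ℝ} (hφ : ∀ x, HasDerivAt φ (φ' x) x) (hφ'm : Measurable φ')
    {K κ : ℝ} (hK : ∀ x, |φ x| ≤ K) (hK' : ∀ x, |φ' x| ≤ K)
    (hκ : ∀ p ≤ 10, gaussianAbsMoment p ≤ κ) (m : ℕ) :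
    Integrable (fun ω => (∑ i ∈ Finset.range m,
      φ ((b i ω + b (i + 1) ω) / 2) * (b (i + 1) ω - b i ω) ^ 5) ^ 2) P ∧
    ∫ ω, (∑ i ∈ Finset.range m,
      φ ((b i ω + b (i + 1) ω) / 2) * (b (i + 1) ω - b i ω) ^ 5) ^ 2 ∂P ≤
      650 * K ^ 2 * κ * s ^ 10 * (m * (m : ℝ) ^ ((1 : ℝ) / 3)) := by
  have hK0 : 0 ≤ K := (abs_nonneg _).trans (hK 0)
  have hκ0 : 0 ≤ κ := (gaussianAbsMoment_nonneg 0).trans (hκ 0 (by norm_num))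
  have hφm : Measurable φ := (continuous_iff_continuousAt.2 fun x => (hφ x).continuousAt).measurable
  have bm := hb.measurable
  set β : ℕ → Ω → ℝ := fun i ω => (b i ω + b (i + 1) ω) / 2 with hβ
  set Δ : ℕ → Ω → ℝ := fun i ω => b (i + 1) ω - b i ω with hΔ
  have hβm : ∀ i, Measurable (β i) := fun i => by fun_prop
  have hΔm : ∀ i, Measurable (Δ i) := fun i => by fun_prop
  have hint : ∀ i j, Integrable (fun ω => φ (β i ω) * Δ i ω ^ 5 * (φ (β j ω) * Δ j ω ^ 5)) P := by
    intro i j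
    have mi := hβm i
    have mj := hβm j
    refine ((abs_integral_mul_pow_mul_pow_le (G := fun ω => φ (β i ω) * φ (β j ω)) (c := K ^ 2)
      (hΔm i) (hΔm j) (by fun_prop) hs.le (hb.map_increment i) (hb.map_increment j)
      (fun ω => ?_) 5 5).1).congr (ae_of_all _ fun ω => by simp only; ring)
    rw [abs_mul, pow_two]
    exact mul_le_mul (hK _) (hK _) (abs_nonneg _) hK0
  have hbound : ∀ i j, ∫ ω, φ (β i ω) * Δ i ω ^ 5 * (φ (β j ω) * Δ j ω ^ 5) ∂P ≤
      130 * K ^ 2 * κ * s ^ 8 * (|∫ ω, Δ i ω * β i ω ∂P| + |∫ ω, Δ i ω * β j ω ∂P| +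
        |∫ ω, Δ i ω * Δ j ω ∂P|) := by
    intro i j
    let W : Fin 4 → Ω → ℝ := ![Δ i, β i, β j, Δ j]
    have hW : HasGaussianLaw (fun ω k => W k ω) P := by
      let p : Fin 4 → (Fin 4 → ℝ) →L[ℝ] ℝ := fun k => ContinuousLinearMap.proj k
      have := (hb.gaussian i j).map_fun (ContinuousLinearMap.pi
        ![p 1 - p 0, (1 / 2 : ℝ) • (p 0 + p 1), (1 / 2 : ℝ) • (p 2 + p 3), p 3 - p 2])
      refine this.congr (ae_of_all _ fun ω => ?_)
      ext k
      fin_cases k <;> simp [W, p, hβ, hΔ] <;> ring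
    have hi1 : ∀ i, Integrable (b i) P := fun i =>
      have := (hb.gaussian 0 0).isProbabilityMeasure
      (hb.memLp i).integrable one_le_two
    have hΔ0 : ∀ i, ∫ ω, Δ i ω ∂P = 0 := fun i => by
      simp only [hΔ]
      rw [integral_sub (hi1 _) (hi1 _), hb.mean, hb.mean, sub_zero]
    have hβ0 : ∀ i, ∫ ω, β i ω ∂P = 0 := fun i => by
      simp only [hβ]
      rw [integral_div, integral_add (hi1 _) (hi1 _), hb.mean, hb.mean]
      simp
    refine (le_abs_self _).trans (abs_integral_weighted_fifth_powers_le hW ?_ ?_ hs hs1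
      (hb.integral_increment_sq i) (hb.integral_increment_sq j) hφ hφ'm hK hK' hκ)
    · intro k
      fin_cases k
      exacts [hΔm i, hβm i, hβm j, hΔm j]
    · intro k
      fin_cases k
      exacts [hΔ0 i, hβ0 i, hβ0 j, hΔ0 j]
  have hsq : ∀ ω, (∑ i ∈ Finset.range m, φ (β i ω) * Δ i ω ^ 5) ^ 2 =
      ∑ j ∈ Finset.range m, ∑ i ∈ Finset.range m,
        φ (β i ω) * Δ i ω ^ 5 * (φ (β j ω) * Δ j ω ^ 5) := by
    intro ω
    rw [pow_two, Finset.sum_mul_sum, Finset.sum_comm]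
  have hcol : ∀ j, Integrable (fun ω => ∑ i ∈ Finset.range m,
      φ (β i ω) * Δ i ω ^ 5 * (φ (β j ω) * Δ j ω ^ 5)) P := fun j =>
    integrable_finsetSum _ fun i _ => hint i j
  simp only [hβ, hΔ] at hsq hcol hbound hint
  simp only [hsq]
  refine ⟨integrable_finsetSum _ fun j _ => hcol j, ?_⟩
  rw [integral_finsetSum _ fun j _ => hcol j]
  calc _ ≤ ∑ j ∈ Finset.range m, 130 * K ^ 2 * κ * s ^ 8 *
        (5 * s ^ 2 * (m : ℝ) ^ ((1 : ℝ) / 3)) := by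
        refine Finset.sum_le_sum fun j hj => ?_
        rw [integral_finsetSum _ fun i _ => hint i j]
        refine (Finset.sum_le_sum fun i _ => hbound i j).trans ?_
        rw [← Finset.mul_sum, Finset.sum_add_distrib, Finset.sum_add_distrib]
        refine mul_le_mul_of_nonneg_left ?_ (by positivity)
        have hjm := Finset.mem_range.1 hj
        linarith [hb.sum_abs_integral_increment_mul_self_midpoint m,
          hb.sum_abs_integral_increment_mul_midpoint_le hjm,
          hb.sum_abs_integral_increment_mul_increment_le hjm]
    _ = _ := by
        rw [Finset.sum_const, Finset.card_range, nsmul_eq_mul]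
        ring

end IsScaledFBMGrid

/-- Maximal inequality for the sums of weighted fifth powers of the increments, by comparison with
the sums at multiples of `l`. -/
theorem IsScaledFBMGrid.measure_exists_le_abs_sum_le {Ω : Type*} [MeasurableSpace Ω]
    {P : Measure Ω} {s : ℝ} {b : ℕ → Ω → ℝ} (hb : IsScaledFBMGrid P s b) (hs : 0 < s)
    (hs1 : s ≤ 1) {φ φ' : ℝ → ℝ} (hφ : ∀ x, HasDerivAt φ (φ' x) x) (hφ'm : Measurable φ')
    {K κ : ℝ} (hK : ∀ x, |φ x| ≤ K) (hK' : ∀ x, |φ' x| ≤ K)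
    (hκ : ∀ p ≤ 20, gaussianAbsMoment p ≤ κ) {ε c : ℝ} (hε : 0 < ε) (hc : 0 ≤ c)
    (N : ℕ) {l : ℕ} (hl : 0 < l) :
    P {ω | ∃ m ≤ N, ε ≤ |∑ i ∈ Finset.range m,
        φ ((b i ω + b (i + 1) ω) / 2) * (b (i + 1) ω - b i ω) ^ 5| +
          c * ∑ i ∈ Finset.range m, |b (i + 1) ω - b i ω| ^ 7} ≤
      ENNReal.ofReal ((3 / ε) ^ 2 * (((N / l : ℕ) + 1) *
          (650 * K ^ 2 * κ * s ^ 10 * (N * (N : ℝ) ^ ((1 : ℝ) / 3)))) +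
        (3 * K / ε) ^ 4 * l ^ 3 * (N * (s ^ 20 * κ)) + 3 * c / ε * (N * (s ^ 7 * κ))) := by
  have hP := (hb.gaussian 0 0).isProbabilityMeasure
  have hK0 : 0 ≤ K := (abs_nonneg _).trans (hK 0)
  have hκ0 : 0 ≤ κ := (gaussianAbsMoment_nonneg 0).trans (hκ 0 (by norm_num))
  set Δ : ℕ → Ω → ℝ := fun i ω => b (i + 1) ω - b i ω with hΔ
  set S : ℕ → Ω → ℝ := fun m ω => ∑ i ∈ Finset.range m,
    φ ((b i ω + b (i + 1) ω) / 2) * (b (i + 1) ω - b i ω) ^ 5 with hS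
  have hSm := fun m => hb.integral_sq_sum_weighted_fifth_powers_le hs hs1 hφ hφ'm hK hK'
    (κ := κ) (fun p hp => hκ p (by omega)) m
  have hΔm : ∀ i, Measurable (Δ i) := fun i => (hb.measurable _).sub (hb.measurable _)
  have hΔp : ∀ p i, Integrable (fun ω => |Δ i ω| ^ p) P := fun p i =>
    integrable_abs_pow_of_map_eq (hΔm i) (hb.map_increment i) p
  have hΔI : ∀ p ≤ 20, ∫ ω, ∑ i ∈ Finset.range N, |Δ i ω| ^ p ∂P ≤ N * (s ^ p * κ) := by
    intro p hp
    rw [integral_finsetSum _ fun i _ => hΔp p i]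
    refine (Finset.sum_le_card_nsmul _ _ (s ^ p * κ) fun i _ => ?_).trans_eq (by simp)
    rw [integral_abs_pow_of_map_eq (hΔm i) hs.le (hb.map_increment i)]
    exact mul_le_mul_of_nonneg_left (hκ p hp) (by positivity)
  have i1 : Integrable (fun ω => ∑ k ∈ Finset.range (N / l + 1), S (k * l) ω ^ 2) P :=
    integrable_finsetSum _ fun k _ => (hSm (k * l)).1
  have i2 : ∀ p, Integrable (fun ω => ∑ i ∈ Finset.range N, |Δ i ω| ^ p) P := fun p =>
    integrable_finsetSum _ fun i _ => hΔp p i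
  set F : Ω → ℝ := fun ω => (3 / ε) ^ 2 * ∑ k ∈ Finset.range (N / l + 1), S (k * l) ω ^ 2 +
    (3 * K / ε) ^ 4 * l ^ 3 * ∑ i ∈ Finset.range N, |Δ i ω| ^ 20 +
    3 * c / ε * ∑ i ∈ Finset.range N, |Δ i ω| ^ 7 with hF
  have j1 := i1.const_mul ((3 / ε) ^ 2)
  have j2 := (i2 20).const_mul ((3 * K / ε) ^ 4 * l ^ 3)
  have j3 := (i2 7).const_mul (3 * c / ε)
  have hFi : Integrable F P := (j1.add j2).add j3
  have hFI : ∫ ω, F ω ∂P ≤ (3 / ε) ^ 2 * (((N / l : ℕ) + 1) *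
      (650 * K ^ 2 * κ * s ^ 10 * (N * (N : ℝ) ^ ((1 : ℝ) / 3)))) +
      (3 * K / ε) ^ 4 * l ^ 3 * (N * (s ^ 20 * κ)) + 3 * c / ε * (N * (s ^ 7 * κ)) := by
    rw [hF, integral_add (by exact j1.add j2) j3, integral_add j1 j2, integral_const_mul,
      integral_const_mul, integral_const_mul]
    refine add_le_add (add_le_add ?_ ?_) ?_
    · refine mul_le_mul_of_nonneg_left ?_ (by positivity)
      rw [integral_finsetSum _ fun k _ => (hSm (k * l)).1]
      refine (Finset.sum_le_card_nsmul _ _ _ fun k hk => (hSm (k * l)).2.trans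
        (mul_le_mul_of_nonneg_left (?_ : _ ≤ N * (N : ℝ) ^ ((1 : ℝ) / 3))
          (by positivity))).trans_eq (by simp)
      have hkN : k * l ≤ N := by
        have := Finset.mem_range.1 hk
        calc k * l ≤ N / l * l := Nat.mul_le_mul_right _ (by omega)
          _ ≤ N := Nat.div_mul_le_self _ _
      have : ((k * l : ℕ) : ℝ) ≤ N := by exact_mod_cast hkN
      gcongr
    · exact mul_le_mul_of_nonneg_left (hΔI 20 le_rfl) (by positivity)
    · exact mul_le_mul_of_nonneg_left (hΔI 7 (by norm_num)) (by positivity)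
  have hF0 : ∀ ω, 0 ≤ F ω := fun ω => by simp only [hF]; positivity
  have hpath : ∀ ω, (∃ m ≤ N, ε ≤ |S m ω| + c * ∑ i ∈ Finset.range m, |Δ i ω| ^ 7) →
      1 ≤ F ω := by
    rintro ω ⟨m, hm, hω⟩
    have n1 : 0 ≤ (3 / ε) ^ 2 * ∑ k ∈ Finset.range (N / l + 1), S (k * l) ω ^ 2 := by positivity
    have n2 : 0 ≤ (3 * K / ε) ^ 4 * l ^ 3 * ∑ i ∈ Finset.range N, |Δ i ω| ^ 20 := by positivity
    have n3 : 0 ≤ 3 * c / ε * ∑ i ∈ Finset.range N, |Δ i ω| ^ 7 := by positivity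
    have hml : m / l * l ≤ m := Nat.div_mul_le_self _ _
    set U := ∑ i ∈ Finset.Ico (m / l * l) m, |Δ i ω| ^ 5 with hU
    have hsplit : |S m ω| ≤ |S (m / l * l) ω| + K * U := by
      have e : S m ω = S (m / l * l) ω + ∑ i ∈ Finset.Ico (m / l * l) m,
          φ ((b i ω + b (i + 1) ω) / 2) * (b (i + 1) ω - b i ω) ^ 5 :=
        (Finset.sum_range_add_sum_Ico _ hml).symm
      rw [e]
      refine (abs_add_le _ _).trans (add_le_add_right ?_ _)
      refine (Finset.abs_sum_le_sum_abs _ _).trans ?_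
      rw [hU, Finset.mul_sum]
      refine Finset.sum_le_sum fun i _ => ?_
      rw [abs_mul, abs_pow]
      exact mul_le_mul_of_nonneg_right (hK _) (by positivity)
    have hsub : ∀ p, ∀ I ⊆ Finset.range N,
        ∑ i ∈ I, |Δ i ω| ^ p ≤ ∑ i ∈ Finset.range N, |Δ i ω| ^ p := fun p I hI =>
      Finset.sum_le_sum_of_subset_of_nonneg hI fun _ _ _ => by positivity
    have h7 := mul_le_mul_of_nonneg_left (hsub 7 (Finset.range m)
      (Finset.range_subset_range.2 hm)) hc
    have hone : ∀ {x : ℝ}, ε / 3 ≤ x → 1 ≤ 3 / ε * x := by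
      intro x hx
      rw [div_mul_eq_mul_div, le_div_iff₀ hε]
      linarith
    by_cases c1 : ε / 3 ≤ |S (m / l * l) ω|
    · have hmem : m / l ∈ Finset.range (N / l + 1) :=
        Finset.mem_range.2 (Nat.lt_succ_of_le (Nat.div_le_div_right hm))
      have h1 := Finset.single_le_sum (f := fun k => S (k * l) ω ^ 2)
        (fun k _ => sq_nonneg _) hmem
      have h2 := one_le_pow₀ (n := 2) (hone c1)
      rw [mul_pow, sq_abs] at h2
      have h3 := mul_le_mul_of_nonneg_left h1 (by positivity : 0 ≤ (3 / ε) ^ 2)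
      simp only [hF]
      linarith
    · by_cases c2 : ε / 3 ≤ K * U
      · have h2 := one_le_pow₀ (n := 4) (hone c2)
        have hcard : (m - m / l * l : ℕ) ≤ l := by
          have := Nat.mod_lt m hl
          have := Nat.div_add_mod' m l
          omega
        have hpm : U ^ 4 ≤ l ^ 3 * ∑ i ∈ Finset.Ico (m / l * l) m, |Δ i ω| ^ 20 := by
          have hJ := pow_sum_le_card_mul_sum_pow (s := Finset.Ico (m / l * l) m)
            (f := fun i => |Δ i ω| ^ 5) (fun i _ => by positivity) 3
          simp only [← pow_mul, Nat.card_Ico] at hJ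
          refine hJ.trans (mul_le_mul_of_nonneg_right ?_ (by positivity))
          have : ((m - m / l * l : ℕ) : ℝ) ≤ l := by exact_mod_cast hcard
          gcongr
        have h3 : U ^ 4 ≤ l ^ 3 * ∑ i ∈ Finset.range N, |Δ i ω| ^ 20 := by
          refine hpm.trans (mul_le_mul_of_nonneg_left (hsub 20 _ fun i hi => ?_) (by positivity))
          rw [Finset.mem_Ico] at hi
          exact Finset.mem_range.2 (by omega)
        have h4 := mul_le_mul_of_nonneg_left h3 (by positivity : 0 ≤ (3 * K / ε) ^ 4)
        have e : (3 / ε * (K * U)) ^ 4 = (3 * K / ε) ^ 4 * U ^ 4 := by ring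
        simp only [hF]
        linarith
      · have c3 : ε / 3 ≤ c * ∑ i ∈ Finset.range N, |Δ i ω| ^ 7 := by linarith
        have h2 := hone c3
        have e : 3 / ε * (c * ∑ i ∈ Finset.range N, |Δ i ω| ^ 7) =
          3 * c / ε * ∑ i ∈ Finset.range N, |Δ i ω| ^ 7 := by ring
        simp only [hF]
        linarith
  calc _ ≤ P {ω | 1 ≤ F ω} := measure_mono hpath
    _ = ENNReal.ofReal (P.real {ω | 1 ≤ F ω}) := by simp
    _ ≤ ENNReal.ofReal (∫ ω, F ω ∂P) := by
        have := mul_meas_ge_le_integral_of_nonneg (ae_of_all _ hF0) hFi 1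
        rw [one_mul] at this
        exact ENNReal.ofReal_le_ofReal this
    _ ≤ _ := ENNReal.ofReal_le_ofReal hFI

theorem abs_le_mul_pow_succ_of_hasDerivAt {F F' : ℝ → ℝ} {C r : ℝ} {k : ℕ} (hC : 0 ≤ C)
    (hF : ∀ u, HasDerivAt F (F' u) u) (h0 : F 0 = 0) (hb : ∀ u, |u| ≤ r → |F' u| ≤ C * |u| ^ k)
    (u : ℝ) (hu : |u| ≤ r) : |F u| ≤ C * |u| ^ (k + 1) := by
  have h := (convex_Icc (-|u|) |u|).norm_image_sub_le_of_norm_hasDerivWithin_le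
    (f := F) (f' := F') (C := C * |u| ^ k) (x := 0) (y := u)
    (fun x _ => (hF x).hasDerivWithinAt)
    (fun x hx => by
      have hx' : |x| ≤ |u| := abs_le.2 hx
      exact (hb x (hx'.trans hu)).trans (by gcongr))
    (by simp) (by simp [neg_abs_le, le_abs_self])
  rw [h0, sub_zero, sub_zero, Real.norm_eq_abs, Real.norm_eq_abs] at h
  rwa [pow_succ, ← mul_assoc]

theorem hasDerivAt_iteratedDeriv {f : ℝ → ℝ} (hf : ContDiff ℝ (⊤ : ℕ∞) f) (k : ℕ) (x : ℝ) :
    HasDerivAt (iteratedDeriv k f) (iteratedDeriv (k + 1) f x) x := by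
  rw [iteratedDeriv_succ]
  exact ((hf.differentiable_iteratedDeriv k (by exact_mod_cast WithTop.coe_lt_top _)) x).hasDerivAt

/-- Symmetric Taylor expansion about the midpoint, uniformly on a bounded interval. -/
theorem exists_midpoint_taylor_bound {f : ℝ → ℝ} (hf : ContDiff ℝ (⊤ : ℕ∞) f) (R : ℝ) :
    ∃ K, 0 ≤ K ∧ ∀ x y, |x| ≤ R → |y| ≤ R →
      |deriv f ((x + y) / 2) * (y - x)| ≤ K * |y - x| ∧
      |iteratedDeriv 3 f ((x + y) / 2) / 24 * (y - x) ^ 3| ≤ K * |y - x| ^ 3 ∧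
      |f y - f x| ≤ K * |y - x| ∧
      |f y - f x - deriv f ((x + y) / 2) * (y - x)| ≤ K * |y - x| ^ 3 ∧
      |f y - f x - deriv f ((x + y) / 2) * (y - x) -
        iteratedDeriv 3 f ((x + y) / 2) / 24 * (y - x) ^ 3| ≤ K * |y - x| ^ 5 := by
  have hd := hasDerivAt_iteratedDeriv hf
  have hbd : ∀ k, ∃ c, ∀ x, |x| ≤ R → |iteratedDeriv k f x| ≤ c := by
    intro k
    obtain ⟨c, hc⟩ := (isCompact_Icc (a := -R) (b := R)).exists_bound_of_continuousOn
      (f := iteratedDeriv k f)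
      (continuous_iff_continuousAt.2 fun x => (hd k x).continuousAt).continuousOn
    exact ⟨c, fun x hx => hc x (abs_le.1 hx)⟩
  obtain ⟨c1, hc1⟩ := hbd 1
  obtain ⟨c3, hc3⟩ := hbd 3
  obtain ⟨c5, hc5⟩ := hbd 5
  rcases lt_or_ge R 0 with hR | hR
  · exact ⟨0, le_rfl, fun x y hx => absurd ((abs_nonneg x).trans hx) (not_le.2 hR)⟩
  have h00 : |(0 : ℝ)| ≤ R := by simpa using hR
  have p1 : 0 ≤ c1 := (abs_nonneg _).trans (hc1 0 h00)
  have p3 : 0 ≤ c3 := (abs_nonneg _).trans (hc3 0 h00)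
  have p5 : 0 ≤ c5 := (abs_nonneg _).trans (hc5 0 h00)
  refine ⟨c1 + c3 + 2 * c5 + 2 * c5 * (2 * R) ^ 2, by positivity, fun x y hx hy => ?_⟩
  have hm : |(x + y) / 2| ≤ R := by
    rw [abs_le] at *
    constructor <;> linarith [hx.1, hx.2, hy.1, hy.2]
  have hdR : |y - x| ≤ 2 * R := by
    rw [abs_le] at *
    constructor <;> linarith [hx.1, hx.2, hy.1, hy.2]
  have q1 : |deriv f ((x + y) / 2) * (y - x)| ≤ c1 * |y - x| := by
    rw [abs_mul, ← iteratedDeriv_one]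
    exact mul_le_mul_of_nonneg_right (hc1 _ hm) (abs_nonneg _)
  have q3 : |iteratedDeriv 3 f ((x + y) / 2) / 24 * (y - x) ^ 3| ≤ c3 * |y - x| ^ 3 := by
    rw [abs_mul, abs_pow, abs_div]
    refine mul_le_mul_of_nonneg_right ?_ (by positivity)
    have := hc3 _ hm
    have h24 : |(24 : ℝ)| = 24 := by norm_num
    rw [h24]
    linarith
  have q0 : |f y - f x| ≤ c1 * |y - x| := by
    have := (convex_Icc (-R) R).norm_image_sub_le_of_norm_hasDerivWithin_le
      (f := iteratedDeriv 0 f) (f' := iteratedDeriv 1 f) (C := c1) (x := x) (y := y)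
      (fun z _ => (hd 0 z).hasDerivWithinAt) (fun z hz => hc1 z (abs_le.2 hz))
      (abs_le.1 hx) (abs_le.1 hy)
    simpa using this
  have q5 : |f y - f x - deriv f ((x + y) / 2) * (y - x) -
      iteratedDeriv 3 f ((x + y) / 2) / 24 * (y - x) ^ 3| ≤ 2 * c5 * |y - x| ^ 5 := by
    set b := (x + y) / 2 with hb
    have hp : ∀ k u, HasDerivAt (fun u => iteratedDeriv k f (b + u))
        (iteratedDeriv (k + 1) f (b + u)) u := fun k u => by
      simpa using (hd k (b + u)).comp_const_add b u
    have hn : ∀ k u, HasDerivAt (fun u => iteratedDeriv k f (b - u))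
        (-iteratedDeriv (k + 1) f (b - u)) u := fun k u => by
      simpa using (hd k (b - u)).comp_const_sub b u
    have g5 : ∀ u, |u| ≤ |y - x| / 2 →
        |iteratedDeriv 5 f (b + u) + iteratedDeriv 5 f (b - u)| ≤ 2 * c5 * |u| ^ 0 := by
      intro u hu
      have hmem : |b + u| ≤ R ∧ |b - u| ≤ R := by
        rcases abs_cases (y - x) with ⟨h, -⟩ | ⟨h, -⟩ <;> rw [h] at hu <;> rw [abs_le] at * <;>
          rw [abs_le] <;> refine ⟨⟨?_, ?_⟩, ?_, ?_⟩ <;>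
          linarith [hx.1, hx.2, hy.1, hy.2, hu.1, hu.2]
      refine (abs_add_le _ _).trans ?_
      linarith [hc5 _ hmem.1, hc5 _ hmem.2]
    have g4 := abs_le_mul_pow_succ_of_hasDerivAt (by positivity)
      (F := fun u => iteratedDeriv 4 f (b + u) - iteratedDeriv 4 f (b - u))
      (fun u => ((hp 4 u).fun_sub (hn 4 u)).congr_deriv (by ring)) (by simp) g5
    have g3 := abs_le_mul_pow_succ_of_hasDerivAt (by positivity)
      (F := fun u => iteratedDeriv 3 f (b + u) + iteratedDeriv 3 f (b - u) -
        2 * iteratedDeriv 3 f b)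
      (fun u => (((hp 3 u).fun_add (hn 3 u)).sub_const _).congr_deriv (by ring))
      (by simp; ring) g4
    have g2 := abs_le_mul_pow_succ_of_hasDerivAt (by positivity)
      (F := fun u => iteratedDeriv 2 f (b + u) - iteratedDeriv 2 f (b - u) -
        u * (2 * iteratedDeriv 3 f b))
      (fun u => (((hp 2 u).fun_sub (hn 2 u)).fun_sub
        ((hasDerivAt_id' u).mul_const _)).congr_deriv (by ring))
      (by simp) g3
    have g1 := abs_le_mul_pow_succ_of_hasDerivAt (by positivity)
      (F := fun u => iteratedDeriv 1 f (b + u) + iteratedDeriv 1 f (b - u) -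
        2 * iteratedDeriv 1 f b - u ^ 2 * iteratedDeriv 3 f b)
      (fun u => ((((hp 1 u).fun_add (hn 1 u)).sub_const _).fun_sub
        (((hasDerivAt_id' u).fun_pow 2).mul_const _)).congr_deriv (by norm_num; ring))
      (by simp; ring) g2
    have g0 := abs_le_mul_pow_succ_of_hasDerivAt (by positivity)
      (F := fun u => iteratedDeriv 0 f (b + u) - iteratedDeriv 0 f (b - u) -
        u * (2 * iteratedDeriv 1 f b) - u ^ 3 * (iteratedDeriv 3 f b / 3))
      (fun u => ((((hp 0 u).fun_sub (hn 0 u)).fun_sub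
        ((hasDerivAt_id' u).mul_const _)).fun_sub
        (((hasDerivAt_id' u).fun_pow 3).mul_const _)).congr_deriv (by norm_num; ring))
      (by simp) g1 ((y - x) / 2) (by rw [abs_div]; simp)
    have e1 : b + (y - x) / 2 = y := by rw [hb]; ring
    have e2 : b - (y - x) / 2 = x := by rw [hb]; ring
    rw [e1, e2, iteratedDeriv_zero, iteratedDeriv_one] at g0
    have e3 : f y - f x - deriv f b * (y - x) - iteratedDeriv 3 f b / 24 * (y - x) ^ 3 =
        f y - f x - (y - x) / 2 * (2 * deriv f b) -
          ((y - x) / 2) ^ 3 * (iteratedDeriv 3 f b / 3) := by ring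
    rw [e3]
    refine g0.trans (mul_le_mul_of_nonneg_left (pow_le_pow_left₀ (abs_nonneg _) ?_ _)
      (by positivity))
    rw [abs_div, abs_two]
    linarith [abs_nonneg (y - x)]
  have hsq : |y - x| ^ 5 ≤ (2 * R) ^ 2 * |y - x| ^ 3 := by
    rw [show |y - x| ^ 5 = |y - x| ^ 2 * |y - x| ^ 3 by ring]
    gcongr
  have w0 := abs_nonneg (y - x)
  refine ⟨q1.trans ?_, q3.trans ?_, q0.trans ?_, ?_, q5.trans ?_⟩
  · gcongr; nlinarith [sq_nonneg (2 * R)]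
  · gcongr; nlinarith [sq_nonneg (2 * R)]
  · gcongr; nlinarith [sq_nonneg (2 * R)]
  · have := abs_add_le (f y - f x - deriv f ((x + y) / 2) * (y - x) -
        iteratedDeriv 3 f ((x + y) / 2) / 24 * (y - x) ^ 3)
        (iteratedDeriv 3 f ((x + y) / 2) / 24 * (y - x) ^ 3)
    rw [sub_add_cancel] at this
    refine this.trans ((add_le_add q5 q3).trans ?_)
    have := mul_le_mul_of_nonneg_left hsq (by positivity : 0 ≤ 2 * c5)
    have h1 : 0 ≤ c1 * |y - x| ^ 3 := by positivity
    have h2 : 0 ≤ 2 * c5 * |y - x| ^ 3 := by positivity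
    linarith
  · gcongr; nlinarith [sq_nonneg (2 * R)]

theorem abs_mul_mul_sub_le {a b c a1 b1 c1 a3 b3 c3 K d : ℝ}
    (ha1 : |a1| ≤ K * d) (hb1 : |b1| ≤ K * d)
    (ha3 : |a3| ≤ K * d ^ 3) (hb3 : |b3| ≤ K * d ^ 3)
    (hb : |b| ≤ K * d) (hc : |c| ≤ K * d)
    (hbb : |b - b1| ≤ K * d ^ 3) (hcc : |c - c1| ≤ K * d ^ 3)
    (har : |a - a1 - a3| ≤ K * d ^ 5) (hbr : |b - b1 - b3| ≤ K * d ^ 5)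
    (hcr : |c - c1 - c3| ≤ K * d ^ 5) :
    |a * b * c - a1 * b1 * c1 - (a3 * b1 * c1 + a1 * b3 * c1 + a1 * b1 * c3)| ≤
      6 * K ^ 3 * d ^ 7 := by
  have e : a * b * c - a1 * b1 * c1 - (a3 * b1 * c1 + a1 * b3 * c1 + a1 * b1 * c3) =
      (a - a1 - a3) * b * c + a3 * (b - b1) * c + a3 * b1 * (c - c1) + a1 * (b - b1 - b3) * c +
        a1 * b3 * (c - c1) + a1 * b1 * (c - c1 - c3) := by ring
  have mul3 : ∀ {x y z u v w : ℝ}, |x| ≤ u → |y| ≤ v → |z| ≤ w → |x * y * z| ≤ u * v * w := by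
    intro x y z u v w h1 h2 h3
    rw [abs_mul, abs_mul]
    have := (abs_nonneg x).trans h1
    have := (abs_nonneg y).trans h2
    gcongr
  rw [e]
  have t1 := mul3 har hb hc
  have t2 := mul3 ha3 hbb hc
  have t3 := mul3 ha3 hb1 hcc
  have t4 := mul3 ha1 hbr hc
  have t5 := mul3 ha1 hb3 hcc
  have t6 := mul3 ha1 hb1 hcr
  refine (abs_add_le _ _).trans ?_
  refine (add_le_add_left (abs_add_le _ _) _).trans ?_
  refine (add_le_add_left (add_le_add_left (abs_add_le _ _) _) _).trans ?_
  refine (add_le_add_left (add_le_add_left (add_le_add_left (abs_add_le _ _) _) _) _).trans ?_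
  refine (add_le_add_left (add_le_add_left (add_le_add_left (add_le_add_left
    (abs_add_le _ _) _) _) _) _).trans ?_
  linarith

/-- Midpoint expansion of a product of three increments, uniformly on a bounded interval. -/
theorem exists_mul_increments_bound {f g h : ℝ → ℝ} (hf : ContDiff ℝ (⊤ : ℕ∞) f)
    (hg : ContDiff ℝ (⊤ : ℕ∞) g) (hh : ContDiff ℝ (⊤ : ℕ∞) h) (R : ℝ) :
    ∃ C, 0 ≤ C ∧ ∀ x y, |x| ≤ R → |y| ≤ R →
      |(f y - f x) * (g y - g x) * (h y - h x) -
        deriv f ((x + y) / 2) * deriv g ((x + y) / 2) * deriv h ((x + y) / 2) * (y - x) ^ 3 -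
        (iteratedDeriv 3 f ((x + y) / 2) * deriv g ((x + y) / 2) * deriv h ((x + y) / 2) +
          deriv f ((x + y) / 2) * iteratedDeriv 3 g ((x + y) / 2) * deriv h ((x + y) / 2) +
          deriv f ((x + y) / 2) * deriv g ((x + y) / 2) * iteratedDeriv 3 h ((x + y) / 2)) / 24 *
          (y - x) ^ 5| ≤ C * |y - x| ^ 7 := by
  obtain ⟨K₁, p₁, H₁⟩ := exists_midpoint_taylor_bound hf R
  obtain ⟨K₂, p₂, H₂⟩ := exists_midpoint_taylor_bound hg R
  obtain ⟨K₃, p₃, H₃⟩ := exists_midpoint_taylor_bound hh R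
  refine ⟨6 * (K₁ + K₂ + K₃) ^ 3, by positivity, fun x y hx hy => ?_⟩
  obtain ⟨f1, f3, -, -, fr⟩ := H₁ x y hx hy
  obtain ⟨g1, g3, g0, gg, gr⟩ := H₂ x y hx hy
  obtain ⟨-, -, h0, hh', hr⟩ := H₃ x y hx hy
  have l₁ : K₁ ≤ K₁ + K₂ + K₃ := by linarith
  have l₂ : K₂ ≤ K₁ + K₂ + K₃ := by linarith
  have l₃ : K₃ ≤ K₁ + K₂ + K₃ := by linarith
  have up : ∀ {k z : ℝ} (p : ℕ), k ≤ K₁ + K₂ + K₃ → z ≤ k * |y - x| ^ p →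
      z ≤ (K₁ + K₂ + K₃) * |y - x| ^ p := fun p hk hz =>
    hz.trans (mul_le_mul_of_nonneg_right hk (by positivity))
  have up1 : ∀ {k z : ℝ}, k ≤ K₁ + K₂ + K₃ → z ≤ k * |y - x| →
      z ≤ (K₁ + K₂ + K₃) * |y - x| := fun hk hz =>
    hz.trans (mul_le_mul_of_nonneg_right hk (abs_nonneg _))
  have := abs_mul_mul_sub_le (up1 l₁ f1) (up1 l₂ g1)
    (up 3 l₁ f3) (up 3 l₂ g3) (up1 l₂ g0) (up1 l₃ h0) (up 3 l₂ gg) (up 3 l₃ hh') (up 5 l₁ fr)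
    (up 5 l₂ gr) (up 5 l₃ hr)
  refine le_of_eq_of_le ?_ this
  congr 1
  ring

/-- A smooth function agrees on a bounded interval with a bounded one of bounded derivative. -/
theorem exists_bounded_cutoff {φ : ℝ → ℝ} (hφ : ContDiff ℝ (⊤ : ℕ∞) φ) {R : ℝ} (hR : 0 < R) :
    ∃ (ψ ψ' : ℝ → ℝ) (K : ℝ), (∀ x, |x| ≤ R → ψ x = φ x) ∧ (∀ x, HasDerivAt ψ (ψ' x) x) ∧
      Measurable ψ' ∧ (∀ x, |ψ x| ≤ K) ∧ ∀ x, |ψ' x| ≤ K := by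
  let b : ContDiffBump (0 : ℝ) := ⟨R, R + 1, hR, by linarith⟩
  have hs : ContDiff ℝ (⊤ : ℕ∞) fun x => b x * φ x := b.contDiff.mul hφ
  have hc : HasCompactSupport fun x => b x * φ x := b.hasCompactSupport.mul_right
  obtain ⟨K₁, h₁⟩ := hc.exists_bound_of_continuous hs.continuous
  have hd : Continuous (deriv fun x => b x * φ x) := hs.continuous_deriv (by simp)
  obtain ⟨K₂, h₂⟩ := hc.deriv.exists_bound_of_continuous hd
  refine ⟨_, _, max K₁ K₂, fun x hx => ?_, fun x => ((hs.differentiable (by simp)) x).hasDerivAt,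
    hd.measurable, fun x => (h₁ x).trans (le_max_left _ _), fun x => (h₂ x).trans (le_max_right _ _)⟩
  have : b x = 1 := b.one_of_mem_closedBall (by simpa [b] using hx)
  simp [this]

theorem IsFBM16.isScaledFBMGrid {Ω : Type*} [MeasureSpace Ω] {B : ℝ → Ω → ℝ} (hB : IsFBM16 B)
    {n : ℕ} {s : ℝ} (hs : s ^ 2 * (n : ℝ) ^ ((1 : ℝ) / 3) = 1) :
    IsScaledFBMGrid (volume : Measure Ω) s (fun i => B ((i : ℝ) / n)) := by
  obtain ⟨hm, -, hgauss, hcov⟩ := hB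
  have hpos : ∀ i : ℕ, 0 ≤ (i : ℝ) / n := fun i => by positivity
  refine ⟨fun i => hm _, fun i j => ⟨isGaussian_of_map_eq_gaussianReal fun L => ?_⟩, fun i => ?_,
    fun i j => ?_⟩
  · have hmeas : Measurable fun ω => ![B ((i : ℝ) / n) ω, B (((i + 1 : ℕ) : ℝ) / n) ω,
        B ((j : ℝ) / n) ω, B (((j + 1 : ℕ) : ℝ) / n) ω] := by
      refine measurable_pi_lambda _ fun k => ?_
      fin_cases k <;> exact hm _
    obtain ⟨v, hv⟩ := hgauss 4 ![(i : ℝ) / n, ((i + 1 : ℕ) : ℝ) / n, (j : ℝ) / n,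
      ((j + 1 : ℕ) : ℝ) / n] (fun k => L (Pi.single k 1))
      (fun k => by fin_cases k <;> exact hpos _)
    refine ⟨0, v, ?_⟩
    rw [Measure.map_map (by fun_prop) hmeas, ← hv]
    congr 1
    ext ω
    rw [Function.comp_apply]
    refine (LinearMap.pi_apply_eq_sum_univ L.toLinearMap _).trans ?_
    refine Finset.sum_congr rfl fun k _ => ?_
    rw [smul_eq_mul, mul_comm]
    congr 1
    · refine congrArg L ?_
      ext l
      simp [Pi.single_apply, eq_comm]
    · fin_cases k <;> rfl
  · obtain ⟨v, hv⟩ := hgauss 1 (fun _ => (i : ℝ) / n) (fun _ => 1) fun _ => hpos i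
    simp only [Finset.univ_unique, Finset.sum_const, Finset.card_singleton, one_smul, one_mul] at hv
    have : ∫ x, x ∂(volume : Measure Ω).map (B ((i : ℝ) / n)) = 0 := by
      rw [show (B ((i : ℝ) / n)) = fun ω => B ((i : ℝ) / n) ω from rfl, hv]
      exact integral_id_gaussianReal
    rwa [integral_map (hm _).aemeasurable (by fun_prop)] at this
  · rw [hcov _ _ (hpos i) (hpos j), ← sub_div, abs_div, Nat.abs_cast,
      Real.div_rpow (by positivity) (by positivity), Real.div_rpow (by positivity) (by positivity),
      Real.div_rpow (by positivity) (by positivity)]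
    have h0 : (n : ℝ) ^ ((1 : ℝ) / 3) ≠ 0 := by
      intro h
      rw [h, mul_zero] at hs
      exact zero_ne_one hs
    rw [eq_div_of_mul_eq h0 hs]
    ring

/-- A continuous process is bounded on compact intervals with large probability. -/
theorem exists_measure_exceedance_le {Ω : Type*} [MeasurableSpace Ω] {P : Measure Ω}
    [IsFiniteMeasure P] {B : ℝ → Ω → ℝ} (hm : ∀ t, Measurable (B t))
    (hc : ∀ ω, Continuous fun t => B t ω) (T : ℝ) {δ : ENNReal} (hδ : 0 < δ) :
    ∃ L : ℕ, 0 < L ∧ P {ω | ∃ q : ℚ, (q : ℝ) ∈ Set.Icc 0 T ∧ (L : ℝ) < |B q ω|} ≤ δ := by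
  set A : ℕ → Set Ω := fun L => {ω | ∃ q : ℚ, (q : ℝ) ∈ Set.Icc 0 T ∧ (L : ℝ) < |B q ω|} with hA
  have hAm : ∀ L, MeasurableSet (A L) := by
    intro L
    have : A L = ⋃ q : ℚ, {ω | (q : ℝ) ∈ Set.Icc 0 T ∧ (L : ℝ) < |B q ω|} := by
      ext ω; simp [hA]
    rw [this]
    exact MeasurableSet.iUnion fun q => (MeasurableSet.const _).inter
      (measurableSet_lt measurable_const (hm q).abs)
  have hanti : Antitone A := by
    rintro L L' hL ω ⟨q, hq, h⟩
    have : (L : ℝ) ≤ L' := by exact_mod_cast hL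
    exact ⟨q, hq, this.trans_lt h⟩
  have hempty : ⋂ L, A L = ∅ := by
    refine Set.eq_empty_of_forall_notMem fun ω hω => ?_
    obtain ⟨C, hC⟩ := (isCompact_Icc (a := (0 : ℝ)) (b := T)).exists_bound_of_continuousOn
      (hc ω).continuousOn
    obtain ⟨L, hL⟩ := exists_nat_ge C
    obtain ⟨q, hq, h⟩ := Set.mem_iInter.1 hω L
    exact absurd ((hC q hq).trans hL) (not_le.2 h)
  have hlim := tendsto_measure_iInter_atTop (μ := P) (fun L => (hAm L).nullMeasurableSet) hanti
    ⟨0, measure_ne_top _ _⟩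
  rw [hempty, measure_empty] at hlim
  obtain ⟨L, hL, hL0⟩ := ((ENNReal.tendsto_nhds_zero.1 hlim δ hδ).and (eventually_gt_atTop 0)).exists
  exact ⟨L, hL0, hL⟩

theorem maximal_bound_le_mul_inv {T K κ ε c x : ℝ} {N l : ℕ} (hT : 0 ≤ T)
    (hκ : 0 ≤ κ) (hε : 0 < ε) (hc : 0 ≤ c) (hx : 1 ≤ x) (hN : (N : ℝ) ≤ T * x ^ 12)
    (hl : x ^ 9 ≤ l) (hl' : (l : ℝ) ≤ 2 * x ^ 9) :
    (3 / ε) ^ 2 * (((N / l : ℕ) + 1) *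
        (650 * K ^ 2 * κ * (x⁻¹ ^ 2) ^ 10 * (N * (N : ℝ) ^ ((1 : ℝ) / 3)))) +
      (3 * K / ε) ^ 4 * l ^ 3 * (N * ((x⁻¹ ^ 2) ^ 20 * κ)) +
      3 * c / ε * (N * ((x⁻¹ ^ 2) ^ 7 * κ)) ≤
    ((3 / ε) ^ 2 * ((T + 1) * (650 * K ^ 2 * κ * (T * T ^ ((1 : ℝ) / 3)))) +
      (3 * K / ε) ^ 4 * (8 * T * κ) + 3 * c / ε * (T * κ)) * x⁻¹ := by
  have hx0 : 0 < x := by linarith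
  have hl0 : (0 : ℝ) < l := (by positivity : 0 < x ^ 9).trans_le hl
  have hdiv : ((N / l : ℕ) : ℝ) + 1 ≤ (T + 1) * x ^ 3 := by
    have h1 : ((N / l : ℕ) : ℝ) ≤ T * x ^ 3 := by
      refine Nat.cast_div_le.trans ((div_le_iff₀ hl0).2 (hN.trans ?_))
      calc T * x ^ 12 = T * x ^ 3 * x ^ 9 := by ring
        _ ≤ T * x ^ 3 * l := by gcongr
    have h2 : 1 ≤ x ^ 3 := one_le_pow₀ hx
    linarith
  have hroot : (N : ℝ) ^ ((1 : ℝ) / 3) ≤ T ^ ((1 : ℝ) / 3) * x ^ 4 := by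
    have h1 : (x ^ 12) ^ ((1 : ℝ) / 3) = x ^ 4 := by
      rw [← Real.rpow_natCast, ← Real.rpow_mul hx0.le, ← Real.rpow_natCast]
      norm_num
    rw [← h1, ← Real.mul_rpow hT (by positivity)]
    exact Real.rpow_le_rpow (by positivity) hN (by norm_num)
  have hT3 : 0 ≤ T ^ ((1 : ℝ) / 3) := Real.rpow_nonneg hT _
  have hy : x⁻¹ ^ 2 ≤ x⁻¹ := by
    have : x⁻¹ ≤ 1 := inv_le_one_of_one_le₀ hx
    have h0 : 0 ≤ x⁻¹ := by positivity
    nlinarith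
  calc _ ≤ (3 / ε) ^ 2 * ((T + 1) * x ^ 3 *
        (650 * K ^ 2 * κ * (x⁻¹ ^ 2) ^ 10 * (T * x ^ 12 * (T ^ ((1 : ℝ) / 3) * x ^ 4)))) +
      (3 * K / ε) ^ 4 * (2 * x ^ 9) ^ 3 * (T * x ^ 12 * ((x⁻¹ ^ 2) ^ 20 * κ)) +
      3 * c / ε * (T * x ^ 12 * ((x⁻¹ ^ 2) ^ 7 * κ)) := by gcongr
    _ = (3 / ε) ^ 2 * ((T + 1) * (650 * K ^ 2 * κ * (T * T ^ ((1 : ℝ) / 3)))) * x⁻¹ +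
      (3 * K / ε) ^ 4 * (8 * T * κ) * x⁻¹ + 3 * c / ε * (T * κ) * x⁻¹ ^ 2 := by
        field_simp
        ring
    _ ≤ (3 / ε) ^ 2 * ((T + 1) * (650 * K ^ 2 * κ * (T * T ^ ((1 : ℝ) / 3)))) * x⁻¹ +
      (3 * K / ε) ^ 4 * (8 * T * κ) * x⁻¹ + 3 * c / ε * (T * κ) * x⁻¹ := by gcongr
    _ = _ := by ring

/-- The telescoped form of the substitution error: `f`, `g`, `h` evaluated along a sequence `x`. -/
theorem sum_substitution_error_eq (f g h p x : ℕ → ℝ) (m : ℕ) :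
    ∑ j ∈ Finset.range m, (h j + h (j + 1)) / 2 *
        ((f j + f (j + 1)) / 2 * (g (j + 1) - g j)) -
      ∑ j ∈ Finset.range m, (h j * f j + h (j + 1) * f (j + 1)) / 2 * (g (j + 1) - g j) +
      1 / 4 * ∑ j ∈ Finset.range m, p j * (x (j + 1) - x j) ^ 3 =
    -(1 / 4) * ∑ j ∈ Finset.range m, ((f (j + 1) - f j) * (g (j + 1) - g j) * (h (j + 1) - h j) -
      p j * (x (j + 1) - x j) ^ 3) := by
  rw [Finset.mul_sum, Finset.mul_sum, ← Finset.sum_sub_distrib, ← Finset.sum_add_distrib]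
  exact Finset.sum_congr rfl fun j _ => by ring

theorem sum_Icc_one_eq_sum_range (F : ℕ → ℝ) (m : ℕ) :
    ∑ j ∈ Finset.Icc 1 m, F j = ∑ j ∈ Finset.range m, F (j + 1) := by
  rw [Finset.range_eq_Ico, Finset.sum_Ico_add' F 0 m 1]
  rfl

/-- Pathwise bound of the substitution error by sums of fifth and seventh powers. -/
theorem abs_substitution_error_le {f g h p ψ : ℝ → ℝ} {C L : ℝ}
    (H : ∀ x y, |x| ≤ L → |y| ≤ L → |(f y - f x) * (g y - g x) * (h y - h x) -
      p ((x + y) / 2) * (y - x) ^ 3 - ψ ((x + y) / 2) * (y - x) ^ 5| ≤ C * |y - x| ^ 7)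
    {x : ℕ → ℝ} {m : ℕ} (hx : ∀ i ≤ m, |x i| ≤ L) :
    |(∑ j ∈ Finset.range m, (h (x j) + h (x (j + 1))) / 2 *
        ((f (x j) + f (x (j + 1))) / 2 * (g (x (j + 1)) - g (x j)))) -
      (∑ j ∈ Finset.range m, (h (x j) * f (x j) + h (x (j + 1)) * f (x (j + 1))) / 2 *
        (g (x (j + 1)) - g (x j))) +
      1 / 4 * ∑ j ∈ Finset.range m, p ((x j + x (j + 1)) / 2) * (x (j + 1) - x j) ^ 3| ≤
    |∑ j ∈ Finset.range m, ψ ((x j + x (j + 1)) / 2) * (x (j + 1) - x j) ^ 5| +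
      C * ∑ j ∈ Finset.range m, |x (j + 1) - x j| ^ 7 := by
  rw [sum_substitution_error_eq (fun j => f (x j)) (fun j => g (x j)) (fun j => h (x j))
    (fun j => p ((x j + x (j + 1)) / 2)) x m, abs_mul]
  set D := ∑ j ∈ Finset.range m, ((f (x (j + 1)) - f (x j)) * (g (x (j + 1)) - g (x j)) *
    (h (x (j + 1)) - h (x j)) - p ((x j + x (j + 1)) / 2) * (x (j + 1) - x j) ^ 3) with hD
  set S := ∑ j ∈ Finset.range m, ψ ((x j + x (j + 1)) / 2) * (x (j + 1) - x j) ^ 5 with hS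
  have hDS : |D - S| ≤ C * ∑ j ∈ Finset.range m, |x (j + 1) - x j| ^ 7 := by
    rw [hD, hS, ← Finset.sum_sub_distrib, Finset.mul_sum]
    refine (Finset.abs_sum_le_sum_abs _ _).trans (Finset.sum_le_sum fun j hj => ?_)
    have := Finset.mem_range.1 hj
    exact H _ _ (hx j (by omega)) (hx (j + 1) (by omega))
  have h1 : |D| ≤ |S| + |D - S| := by
    have := abs_add_le S (D - S)
    rwa [add_sub_cancel] at this
  have h2 : |(-(1 / 4) : ℝ)| = 1 / 4 := by norm_num [abs_div]
  rw [h2]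
  linarith [abs_nonneg D]

/-- Substitution rule: if `dM = X dY` with `X = f(B)`, `Y = g(B)`, `Z = h(B)`, then
`Z dM = ZX dY - (1/4)(f'g'h')(B) d⟦B⟧`, at the level of Riemann-sum representatives.
Here `M_n(t) = ∑_{j=1}^{⌊nt⌋} ((X(t_{j-1})+X(t_j))/2)(Y(t_j)-Y(t_{j-1}))` and
`δ_j(M_n) = M_n(t_j) - M_n(t_{j-1})`. -/
theorem stmt18 {Ω : Type*} [MeasureSpace Ω] [IsProbabilityMeasure (volume : Measure Ω)]
    (B : ℝ → Ω → ℝ) (hB : IsFBM16 B)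
    (f g h : ℝ → ℝ) (hf : ContDiff ℝ (⊤ : ℕ∞) f) (hg : ContDiff ℝ (⊤ : ℕ∞) g) (hh : ContDiff ℝ (⊤ : ℕ∞) h)
    (X Y Z : ℝ → Ω → ℝ)
    (hX : ∀ t ω, X t ω = f (B t ω)) (hY : ∀ t ω, Y t ω = g (B t ω))
    (hZ : ∀ t ω, Z t ω = h (B t ω))
    (M : ℕ → ℝ → Ω → ℝ)
    (hM : ∀ (n : ℕ) (t : ℝ) (ω : Ω),
      M n t ω = ∑ j ∈ Finset.Icc 1 ⌊(n : ℝ) * t⌋₊,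
        ((X (((j : ℝ) - 1) / n) ω + X ((j : ℝ) / n) ω) / 2) *
          (Y ((j : ℝ) / n) ω - Y (((j : ℝ) - 1) / n) ω)) :
    ∀ T > (0 : ℝ), ∀ ε > (0 : ℝ),
      Tendsto (fun n : ℕ =>
          volume {ω : Ω | ε ≤
            ⨆ t ∈ Set.Icc (0 : ℝ) T,
              |(∑ j ∈ Finset.Icc 1 ⌊(n : ℝ) * t⌋₊,
                  ((Z (((j : ℝ) - 1) / n) ω + Z ((j : ℝ) / n) ω) / 2) *
                    (M n ((j : ℝ) / n) ω - M n (((j : ℝ) - 1) / n) ω))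
                - (∑ j ∈ Finset.Icc 1 ⌊(n : ℝ) * t⌋₊,
                    ((Z (((j : ℝ) - 1) / n) ω * X (((j : ℝ) - 1) / n) ω
                        + Z ((j : ℝ) / n) ω * X ((j : ℝ) / n) ω) / 2) *
                      (Y ((j : ℝ) / n) ω - Y (((j : ℝ) - 1) / n) ω))
                + (1 / 4) *
                    ∑ j ∈ Finset.Icc 1 ⌊(n : ℝ) * t⌋₊,
                      (deriv f ((B (((j : ℝ) - 1) / n) ω + B ((j : ℝ) / n) ω) / 2) *
                        deriv g ((B (((j : ℝ) - 1) / n) ω + B ((j : ℝ) / n) ω) / 2) *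
                        deriv h ((B (((j : ℝ) - 1) / n) ω + B ((j : ℝ) / n) ω) / 2)) *
                      (B ((j : ℝ) / n) ω - B (((j : ℝ) - 1) / n) ω) ^ 3|})
        atTop (𝓝 0) := by
  intro T hT ε hε
  have hB' := hB
  obtain ⟨hBm, hBc, -, -⟩ := hB'
  refine ENNReal.tendsto_nhds_zero.2 fun δ hδ => ?_
  obtain ⟨L, hL0, hL⟩ := exists_measure_exceedance_le (P := (volume : Measure Ω)) hBm hBc T
    (ENNReal.half_pos hδ.ne')
  have hL0' : (0 : ℝ) < L := by exact_mod_cast hL0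
  obtain ⟨C, hC, hTaylor⟩ := exists_mul_increments_bound hf hg hh L
  have hd1 : ∀ {u : ℝ → ℝ}, ContDiff ℝ (⊤ : ℕ∞) u → ContDiff ℝ (⊤ : ℕ∞) (deriv u) :=
    fun hu => by simpa using hu.iterate_deriv 1
  have hd3 : ∀ {u : ℝ → ℝ}, ContDiff ℝ (⊤ : ℕ∞) u → ContDiff ℝ (⊤ : ℕ∞) (iteratedDeriv 3 u) :=
    fun hu => by rw [iteratedDeriv_eq_iterate]; exact hu.iterate_deriv 3
  obtain ⟨ψ, ψ', K, hψ, hψd, hψm, hK, hK'⟩ := exists_bounded_cutoff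
    (φ := fun x => (iteratedDeriv 3 f x * deriv g x * deriv h x +
      deriv f x * iteratedDeriv 3 g x * deriv h x +
      deriv f x * deriv g x * iteratedDeriv 3 h x) / 24)
    (((((hd3 hf).mul (hd1 hg)).mul (hd1 hh)).add (((hd1 hf).mul (hd3 hg)).mul (hd1 hh))).add
      (((hd1 hf).mul (hd1 hg)).mul (hd3 hh)) |>.div_const 24) hL0'
  obtain ⟨κ, hκ⟩ : ∃ κ, ∀ p ≤ 20, gaussianAbsMoment p ≤ κ :=
    ⟨∑ p ∈ Finset.range 21, gaussianAbsMoment p, fun p hp =>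
      Finset.single_le_sum (fun q _ => gaussianAbsMoment_nonneg q)
        (Finset.mem_range.2 (by omega))⟩
  have hκ0 : 0 ≤ κ := (gaussianAbsMoment_nonneg 0).trans (hκ 0 (by norm_num))
  set A := (3 / (ε / 2)) ^ 2 * ((T + 1) * (650 * K ^ 2 * κ * (T * T ^ ((1 : ℝ) / 3)))) +
      (3 * K / (ε / 2)) ^ 4 * (8 * T * κ) + 3 * C / (ε / 2) * (T * κ) with hA
  have hlim : Tendsto (fun n : ℕ => ENNReal.ofReal (A * ((n : ℝ) ^ ((1 : ℝ) / 12))⁻¹)) atTop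
      (𝓝 0) := by
    have h1 : Tendsto (fun n : ℕ => (n : ℝ) ^ ((1 : ℝ) / 12)) atTop atTop :=
      (tendsto_rpow_atTop (by norm_num)).comp tendsto_natCast_atTop_atTop
    have h2 := ENNReal.tendsto_ofReal (h1.inv_tendsto_atTop.const_mul A)
    simpa using h2
  filter_upwards [ENNReal.tendsto_nhds_zero.1 hlim _ (ENNReal.half_pos hδ.ne'),
    eventually_gt_atTop 0] with n hn hn0
  have hnR : (0 : ℝ) < n := by exact_mod_cast hn0
  have hn1 : (1 : ℝ) ≤ n := by exact_mod_cast hn0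
  set x := (n : ℝ) ^ ((1 : ℝ) / 12) with hx
  have hx1 : 1 ≤ x := Real.one_le_rpow hn1 (by norm_num)
  have hx0 : 0 < x := by linarith
  have hx12 : x ^ 12 = n := by
    rw [hx, ← Real.rpow_natCast, ← Real.rpow_mul hnR.le]
    norm_num
  have hx4 : (n : ℝ) ^ ((1 : ℝ) / 3) = x ^ 4 := by
    rw [hx, ← Real.rpow_natCast, ← Real.rpow_mul hnR.le]
    norm_num
  have hgrid : IsScaledFBMGrid (volume : Measure Ω) (x⁻¹ ^ 2) fun i => B ((i : ℝ) / n) :=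
    hB.isScaledFBMGrid (by rw [hx4]; field_simp)
  set N := ⌊(n : ℝ) * T⌋₊ with hN
  have hNle : (N : ℝ) ≤ T * x ^ 12 := by
    rw [hx12, mul_comm T]
    exact Nat.floor_le (by positivity)
  have hx9 : 1 ≤ x ^ 9 := one_le_pow₀ hx1
  have hl : x ^ 9 ≤ (⌈x ^ 9⌉₊ : ℝ) := Nat.le_ceil _
  have hl' : (⌈x ^ 9⌉₊ : ℝ) ≤ 2 * x ^ 9 := by
    linarith [(Nat.ceil_lt_add_one (by positivity : 0 ≤ x ^ 9)).le]
  have hmax := hgrid.measure_exists_le_abs_sum_le (by positivity)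
    (pow_le_one₀ (by positivity) (inv_le_one_of_one_le₀ hx1)) hψd hψm hK hK' hκ
    (half_pos hε) hC N (l := ⌈x ^ 9⌉₊) (Nat.ceil_pos.2 (by positivity))
  have hmax' := hmax.trans ((ENNReal.ofReal_le_ofReal (maximal_bound_le_mul_inv hT.le hκ0
    (half_pos hε) hC hx1 hNle hl hl')).trans hn)
  refine (measure_mono ?_).trans ((measure_union_le _ _).trans
    ((add_le_add hL hmax').trans_eq (ENNReal.add_halves δ)))
  intro ω hω
  by_contra hcon
  rw [Set.mem_union, not_or] at hcon
  obtain ⟨hb1, hb2⟩ := hcon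
  simp only [Set.mem_ofPred_eq, not_exists, not_and, not_lt, not_le] at hb1 hb2
  have hbd : ∀ i ≤ N, |B ((i : ℝ) / n) ω| ≤ L := by
    intro i hi
    have := hb1 ((i : ℚ) / n) (by
      push_cast
      refine ⟨by positivity, (div_le_iff₀ hnR).2 ?_⟩
      rw [mul_comm]
      exact (Nat.le_floor_iff (by positivity)).1 hi)
    simpa using this
  have hMdiff : ∀ j : ℕ, M n (((j + 1 : ℕ) : ℝ) / n) ω - M n ((j : ℝ) / n) ω =
      (X ((j : ℝ) / n) ω + X (((j + 1 : ℕ) : ℝ) / n) ω) / 2 *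
        (Y (((j + 1 : ℕ) : ℝ) / n) ω - Y ((j : ℝ) / n) ω) := by
    intro j
    rw [hM, hM, mul_div_cancel₀ _ hnR.ne', mul_div_cancel₀ _ hnR.ne', Nat.floor_natCast,
      Nat.floor_natCast, Finset.sum_Icc_succ_top (by omega)]
    simp
  refine absurd hω (not_le.2 (lt_of_le_of_lt ?_ (half_lt_self hε)))
  refine Real.iSup_le (fun t => Real.iSup_le (fun ht => ?_) (half_pos hε).le) (half_pos hε).le
  have hmN : ⌊(n : ℝ) * t⌋₊ ≤ N := Nat.floor_le_floor (by gcongr; exact ht.2)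
  set m := ⌊(n : ℝ) * t⌋₊
  have hcast : ∀ j : ℕ, ((j + 1 : ℕ) : ℝ) - 1 = j := fun j => by push_cast; ring
  simp only [sum_Icc_one_eq_sum_range, hcast, hMdiff, hX, hY, hZ]
  refine le_trans (abs_substitution_error_le (p := fun y => deriv f y * deriv g y * deriv h y)
    (ψ := ψ) (C := C) (L := L) (x := fun i => B ((i : ℝ) / n) ω) ?_ ?_) (hb2 m hmN).le
  · intro y z hy hz
    have hyz : |(y + z) / 2| ≤ L := by
      rw [abs_le] at *
      constructor <;> linarith [hy.1, hy.2, hz.1, hz.2]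
    rw [hψ _ hyz]
    exact hTaylor y z hy hz
  · exact fun i hi => hbd i (hi.trans hmN)
end
end

section
/- Let f, g : ℝ → ℝ be infinitely differentiable and set X = f(B), Y = g(B). Then for every T > 0, sup_{0 ≤ t ≤ T} | ∑_{j=1}^{⌊nt⌋} ((X(t_{j−1}) + X(t_j))/2)(Y(t_j) − Y(t_{j−1}))³ − ∑_{j=1}^{⌊nt⌋} f(β_{j,n}) (g'(β_{j,n}))³ (ΔB_{j,n})³ | → 0 in probability as n → ∞. (This identifies the integral ∫ X d⟦Y⟧ against the signed cubic variation of Y with ∫ f(B)(g'(B))³ d⟦B⟧ at the level of Riemann-sum representatives.) -/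
open MeasureTheory ProbabilityTheory Filter Topology

noncomputable section

/-- The absolute moment of order `p` of the standard Gaussian law. -/
def absMoment (p : ℕ) : ℝ := ∫ x, |x| ^ p ∂gaussianReal 0 1

lemma absMoment_nonneg (p : ℕ) : 0 ≤ absMoment p :=
  integral_nonneg fun _ => by positivity

section Gaussian

variable {Ω : Type*} [MeasurableSpace Ω] {P : Measure Ω}

lemma integrable_abs_pow {Z : Ω → ℝ} (hZ : HasGaussianLaw Z P) (p : ℕ) :
    Integrable (fun ω => |Z ω| ^ p) P := by
  have := hZ.isProbabilityMeasure
  have h := (hZ.memLp (p := p) (by simp)).integrable_norm_pow'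
  simpa using h

lemma integral_abs_pow {Z : Ω → ℝ} (hZ : HasGaussianLaw Z P) (h0 : ∫ ω, Z ω ∂P = 0)
    {s : ℝ} (hs : 0 ≤ s) (hv : ∫ ω, Z ω ^ 2 ∂P = s ^ 2) (p : ℕ) :
    ∫ ω, |Z ω| ^ p ∂P = absMoment p * s ^ p := by
  have hP := hZ.isProbabilityMeasure
  have hvar : Var[Z; P] = s ^ 2 := by
    rw [variance_eq_sub hZ.memLp_two]
    simp [h0, hv]
  have hmap := hZ.map_eq_gaussianReal
  rw [hvar, h0] at hmap
  have h1 : gaussianReal 0 (s ^ 2).toNNReal = (gaussianReal 0 1).map (s * ·) := by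
    rw [gaussianReal_map_const_mul]
    congr 1
    · simp
    · ext; simp [sq_nonneg]
  calc ∫ ω, |Z ω| ^ p ∂P = ∫ x, |x| ^ p ∂(P.map Z) := by
        rw [integral_map hZ.aemeasurable (by fun_prop)]
    _ = ∫ x, |s * x| ^ p ∂(gaussianReal 0 1) := by
        rw [hmap, h1, integral_map (by fun_prop) (by fun_prop)]
    _ = absMoment p * s ^ p := by
        simp_rw [abs_mul, mul_pow, abs_of_nonneg hs]
        rw [integral_const_mul, absMoment, mul_comm]

lemma integral_pow_five_eq_zero {U : Ω → ℝ} (hU : HasGaussianLaw U P)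
    (h0 : ∫ ω, U ω ∂P = 0) : ∫ ω, U ω ^ 5 ∂P = 0 := by
  have hmap := hU.map_eq_gaussianReal
  rw [h0] at hmap
  set v := Var[U; P].toNNReal
  have h1 : ∫ ω, U ω ^ 5 ∂P = ∫ x, x ^ 5 ∂gaussianReal 0 v := by
    rw [← hmap, integral_map hU.aemeasurable (by fun_prop)]
  have h2 : ∫ x, x ^ 5 ∂gaussianReal 0 v = -∫ x, x ^ 5 ∂gaussianReal 0 v := by
    conv_lhs => rw [← neg_zero, ← gaussianReal_map_neg]
    rw [integral_map (by fun_prop) (by fun_prop), ← integral_neg]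
    congr with x
    ring
  linarith

lemma integral_mul_pow_five_eq_zero {X : Ω → ℝ × ℝ × ℝ} {U : Ω → ℝ}
    (h : HasGaussianLaw (fun ω => (X ω, U ω)) P) (h0 : ∫ ω, U ω ∂P = 0)
    (h1 : cov[fun ω => (X ω).1, U; P] = 0) (h2 : cov[fun ω => (X ω).2.1, U; P] = 0)
    (h3 : cov[fun ω => (X ω).2.2, U; P] = 0)
    {F : ℝ × ℝ × ℝ → ℝ} (hF : Continuous F) :
    ∫ ω, F (X ω) * U ω ^ 5 ∂P = 0 := by
  have hP := h.isProbabilityMeasure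
  have hX : HasGaussianLaw X P := h.map (.fst ℝ _ _)
  have hU : HasGaussianLaw U P := h.map (.snd ℝ _ _)
  have hX1 : HasGaussianLaw (fun ω => (X ω).1) P := hX.map (.fst ℝ _ _)
  have hX23 : HasGaussianLaw (fun ω => (X ω).2) P := hX.map (.snd ℝ _ _)
  have hX2 : HasGaussianLaw (fun ω => (X ω).2.1) P := hX23.map (.fst ℝ _ _)
  have hX3 : HasGaussianLaw (fun ω => (X ω).2.2) P := hX23.map (.snd ℝ _ _)
  have hind : IndepFun X U P := by
    refine h.indepFun_of_covariance_strongDual fun L₁ L₂ => ?_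
    have e1 : L₁ ∘ X = (fun ω => L₁ (1, 0, 0) * (X ω).1) +
        ((fun ω => L₁ (0, 1, 0) * (X ω).2.1) + fun ω => L₁ (0, 0, 1) * (X ω).2.2) := by
      ext ω
      have : X ω = (X ω).1 • ((1, 0, 0) : ℝ × ℝ × ℝ) +
        ((X ω).2.1 • ((0, 1, 0) : ℝ × ℝ × ℝ) + (X ω).2.2 • ((0, 0, 1) : ℝ × ℝ × ℝ)) := by
        ext <;> simp
      simp only [Function.comp_apply, Pi.add_apply]
      conv_lhs => rw [this]
      simp only [map_add, map_smul, smul_eq_mul]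
      ring
    have e2 : L₂ ∘ U = fun ω => L₂ 1 * U ω := by
      ext ω
      simpa [mul_comm] using L₂.map_smul (U ω) 1
    rw [e1, e2, covariance_add_left, covariance_add_left]
    · simp [covariance_const_mul_left, covariance_const_mul_right, h1, h2, h3]
    · exact hX2.memLp_two.const_mul _
    · exact hX3.memLp_two.const_mul _
    · exact hU.memLp_two.const_mul _
    · exact hX1.memLp_two.const_mul _
    · exact (hX2.memLp_two.const_mul _).add (hX3.memLp_two.const_mul _)
    · exact hU.memLp_two.const_mul _
  have := (hind.comp (φ := F) (ψ := fun x => x ^ 5) hF.measurable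
    (by fun_prop)).integral_fun_mul_eq_mul_integral
    (hF.measurable.comp_aemeasurable hX.aemeasurable).aestronglyMeasurable
    ((by fun_prop : Measurable fun x : ℝ => x ^ 5).comp_aemeasurable
      hU.aemeasurable).aestronglyMeasurable
  simp only [Function.comp_def] at this
  rw [this, integral_pow_five_eq_zero hU h0, mul_zero]

lemma abs_pow_five_sub_le {v u c : ℝ} (hc : |c| ≤ 1) :
    |v ^ 5 - (v - c * u) ^ 5| ≤ 5 * (|c| * |u|) * (|v| + |u|) ^ 4 := by
  set w := v - c * u with hw
  set m := |v| + |u|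
  have hv : |v| ≤ m := le_add_of_nonneg_right (abs_nonneg _)
  have hcu : |c * u| ≤ |u| := by
    rw [abs_mul]; exact mul_le_of_le_one_left (abs_nonneg _) hc
  have hw' : |w| ≤ m := (abs_sub _ _).trans (add_le_add le_rfl hcu)
  have e : v ^ 5 - w ^ 5 =
      (c * u) * (v ^ 4 + v ^ 3 * w + v ^ 2 * w ^ 2 + v * w ^ 3 + w ^ 4) := by
    have : c * u = v - w := by rw [hw]; ring
    rw [this]; ring
  have hm : ∀ i j : ℕ, i + j = 4 → |v ^ i * w ^ j| ≤ m ^ 4 := by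
    intro i j h
    rw [abs_mul, abs_pow, abs_pow, ← h, pow_add]
    gcongr
  have : |v ^ 4 + v ^ 3 * w + v ^ 2 * w ^ 2 + v * w ^ 3 + w ^ 4| ≤ 5 * m ^ 4 := by
    have h0 := abs_le.1 (hm 4 0 rfl)
    have h1 := abs_le.1 (hm 3 1 rfl)
    have h2 := abs_le.1 (hm 2 2 rfl)
    have h3 := abs_le.1 (hm 1 3 rfl)
    have h4 := abs_le.1 (hm 0 4 rfl)
    simp only [pow_zero, pow_one, mul_one, one_mul] at h0 h1 h2 h3 h4
    rw [abs_le]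
    constructor <;> linarith [h0.1, h0.2, h1.1, h1.2, h2.1, h2.2, h3.1, h3.2, h4.1, h4.2]
  rw [e, abs_mul, abs_mul]
  calc |c| * |u| * _ ≤ |c| * |u| * (5 * m ^ 4) := by gcongr
    _ = _ := by ring

lemma pow_mul_pow_le_add {x y : ℝ} (hx : 0 ≤ x) (hy : 0 ≤ y) (i j : ℕ) :
    x ^ i * y ^ j ≤ x ^ (i + j) + y ^ (i + j) := by
  rcases le_total x y with h | h
  · calc x ^ i * y ^ j ≤ y ^ i * y ^ j := by gcongr
      _ = y ^ (i + j) := (pow_add ..).symm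
      _ ≤ _ := le_add_of_nonneg_left (by positivity)
  · calc x ^ i * y ^ j ≤ x ^ i * x ^ j := by gcongr
      _ = x ^ (i + j) := (pow_add ..).symm
      _ ≤ _ := le_add_of_nonneg_right (by positivity)

lemma abs_mul_pow_five_sub_le {φ : ℝ → ℝ} {M L : ℝ} (hM : ∀ x, |φ x| ≤ M) (hL0 : 0 ≤ L)
    (hL : ∀ x y, |φ x - φ y| ≤ L * |x - y|) {a p q c : ℝ} (hp : |p| ≤ a) (hq : |q| ≤ a)
    (hc : |c| ≤ a) (hc1 : |c| ≤ 1) (x y v u : ℝ) :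
    |φ x * φ y * v ^ 5 * u ^ 5
        - φ (x - p * u) * φ (y - q * u) * (v - c * u) ^ 5 * u ^ 5| ≤
      a * (2 * L * M * (|u| ^ 11 + |v| ^ 11) + 2560 * M ^ 2 * (|u| ^ 10 + |v| ^ 10)) := by
  have ha : 0 ≤ a := (abs_nonneg _).trans hp
  have hM0 : 0 ≤ M := (abs_nonneg _).trans (hM 0)
  set x' := x - p * u
  set y' := y - q * u
  set v' := v - c * u
  have hx : |φ x - φ x'| ≤ L * (a * |u|) := (hL _ _).trans <| by
    simp only [x', sub_sub_cancel, abs_mul]; gcongr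
  have hy : |φ y - φ y'| ≤ L * (a * |u|) := (hL _ _).trans <| by
    simp only [y', sub_sub_cancel, abs_mul]; gcongr
  have hv : |v ^ 5 - v' ^ 5| ≤ 5 * (a * |u|) * (|v| + |u|) ^ 4 :=
    (abs_pow_five_sub_le hc1).trans (by gcongr)
  have e : φ x * φ y * v ^ 5 * u ^ 5 - φ x' * φ y' * v' ^ 5 * u ^ 5 =
      (φ x - φ x') * φ y * (v ^ 5 * u ^ 5) + φ x' * (φ y - φ y') * (v ^ 5 * u ^ 5)
        + φ x' * φ y' * ((v ^ 5 - v' ^ 5) * u ^ 5) := by ring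
  have h11 : |u| ^ 6 * |v| ^ 5 ≤ |u| ^ 11 + |v| ^ 11 :=
    pow_mul_pow_le_add (abs_nonneg _) (abs_nonneg _) 6 5
  have h10 : |u| ^ 6 * (|v| + |u|) ^ 4 ≤ 512 * (|u| ^ 10 + |v| ^ 10) := by
    calc |u| ^ 6 * (|v| + |u|) ^ 4 ≤ (|u| + |v|) ^ 6 * (|v| + |u|) ^ 4 := by
          gcongr; exact le_add_of_nonneg_right (abs_nonneg _)
      _ = (|u| + |v|) ^ 10 := by ring
      _ ≤ 2 ^ (10 - 1) * (|u| ^ 10 + |v| ^ 10) :=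
          add_pow_le (abs_nonneg _) (abs_nonneg _) 10
      _ = _ := by norm_num
  have t1 : |(φ x - φ x') * φ y * (v ^ 5 * u ^ 5)| ≤ a * (L * M * (|u| ^ 11 + |v| ^ 11)) := by
    rw [abs_mul, abs_mul, abs_mul, abs_pow, abs_pow]
    calc |φ x - φ x'| * |φ y| * (|v| ^ 5 * |u| ^ 5)
        ≤ (L * (a * |u|)) * M * (|v| ^ 5 * |u| ^ 5) := by gcongr; exact hM y
      _ = a * (L * M * (|u| ^ 6 * |v| ^ 5)) := by ring
      _ ≤ _ := by gcongr
  have t2 : |φ x' * (φ y - φ y') * (v ^ 5 * u ^ 5)| ≤ a * (L * M * (|u| ^ 11 + |v| ^ 11)) := by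
    rw [abs_mul, abs_mul, abs_mul, abs_pow, abs_pow]
    calc |φ x'| * |φ y - φ y'| * (|v| ^ 5 * |u| ^ 5)
        ≤ M * (L * (a * |u|)) * (|v| ^ 5 * |u| ^ 5) := by gcongr; exact hM x'
      _ = a * (L * M * (|u| ^ 6 * |v| ^ 5)) := by ring
      _ ≤ _ := by gcongr
  have t3 : |φ x' * φ y' * ((v ^ 5 - v' ^ 5) * u ^ 5)| ≤
      a * (2560 * M ^ 2 * (|u| ^ 10 + |v| ^ 10)) := by
    rw [abs_mul, abs_mul, abs_mul, abs_pow]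
    calc |φ x'| * |φ y'| * (|v ^ 5 - v' ^ 5| * |u| ^ 5)
        ≤ M * M * (5 * (a * |u|) * (|v| + |u|) ^ 4 * |u| ^ 5) := by
          gcongr
          · exact hM x'
          · exact hM y'
      _ = 5 * a * M ^ 2 * (|u| ^ 6 * (|v| + |u|) ^ 4) := by ring
      _ ≤ 5 * a * M ^ 2 * (512 * (|u| ^ 10 + |v| ^ 10)) := by gcongr
      _ = _ := by ring
  rw [e]
  calc _ ≤ _ := abs_add_three _ _ _
    _ ≤ _ := add_le_add (add_le_add t1 t2) t3
    _ = _ := by ring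

/-- The constant in `abs_integral_mul_pow_five_le`. -/
def decorConst (L M : ℝ) : ℝ := 4 * L * M * absMoment 11 + 5120 * M ^ 2 * absMoment 10

lemma decorConst_nonneg {L M : ℝ} (hL : 0 ≤ L) (hM : 0 ≤ M) : 0 ≤ decorConst L M := by
  have := absMoment_nonneg 10
  have := absMoment_nonneg 11
  unfold decorConst
  positivity

lemma integrable_mul_pow_five {X Y V U : Ω → ℝ}
    (h : HasGaussianLaw (fun ω => ((X ω, Y ω, V ω), U ω)) P)
    {φ : ℝ → ℝ} (hφ : Continuous φ) {M : ℝ} (hM : ∀ x, |φ x| ≤ M) :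
    Integrable (fun ω => φ (X ω) * φ (Y ω) * V ω ^ 5 * U ω ^ 5) P := by
  have hM0 : 0 ≤ M := (abs_nonneg _).trans (hM 0)
  have hU : HasGaussianLaw U P := h.map (.snd ℝ _ _)
  have hV : HasGaussianLaw V P :=
    h.map ((ContinuousLinearMap.snd ℝ ℝ ℝ ∘L .snd ℝ ℝ (ℝ × ℝ)) ∘L .fst ℝ _ _)
  refine Integrable.mono' (g := fun ω => M ^ 2 * (|V ω| ^ 10 + |U ω| ^ 10))
    (((integrable_abs_pow hV 10).add (integrable_abs_pow hU 10)).const_mul _) ?_ ?_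
  · exact ((by fun_prop : Continuous fun z : (ℝ × ℝ × ℝ) × ℝ =>
      φ z.1.1 * φ z.1.2.1 * z.1.2.2 ^ 5 * z.2 ^ 5).measurable.comp_aemeasurable
        h.aemeasurable).aestronglyMeasurable
  · refine ae_of_all _ fun ω => ?_
    rw [Real.norm_eq_abs, abs_mul, abs_mul, abs_mul, abs_pow, abs_pow]
    calc |φ (X ω)| * |φ (Y ω)| * |V ω| ^ 5 * |U ω| ^ 5
        ≤ M * M * |V ω| ^ 5 * |U ω| ^ 5 := by
          gcongr
          · exact hM _
          · exact hM _
      _ = M ^ 2 * (|V ω| ^ 5 * |U ω| ^ 5) := by ring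
      _ ≤ _ := by
          gcongr
          exact pow_mul_pow_le_add (abs_nonneg _) (abs_nonneg _) 5 5

/-- Removing from `X`, `Y` and `V` their projections on `U` makes them independent of `U`, so the
expectation is controlled by the size of these projections. -/
lemma abs_integral_mul_pow_five_le {X Y V U : Ω → ℝ}
    (h : HasGaussianLaw (fun ω => ((X ω, Y ω, V ω), U ω)) P)
    (hU0 : ∫ ω, U ω ∂P = 0) (hV0 : ∫ ω, V ω ∂P = 0)
    {s a : ℝ} (hs : 0 < s)
    (hUs : ∫ ω, U ω ^ 2 ∂P = s ^ 2) (hVs : ∫ ω, V ω ^ 2 ∂P = s ^ 2)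
    (hXU : |∫ ω, X ω * U ω ∂P| ≤ a * s ^ 2) (hYU : |∫ ω, Y ω * U ω ∂P| ≤ a * s ^ 2)
    (hVU : |∫ ω, V ω * U ω ∂P| ≤ a * s ^ 2)
    {φ : ℝ → ℝ} (hφ : Continuous φ) {M L : ℝ} (hM : ∀ x, |φ x| ≤ M) (hL0 : 0 ≤ L)
    (hL : ∀ x y, |φ x - φ y| ≤ L * |x - y|) (hs1 : s ≤ 1) :
    |∫ ω, φ (X ω) * φ (Y ω) * V ω ^ 5 * U ω ^ 5 ∂P| ≤ a * (decorConst L M * s ^ 10) := by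
  have hP := h.isProbabilityMeasure
  have hM0 : 0 ≤ M := (abs_nonneg _).trans (hM 0)
  have hs2 : 0 < s ^ 2 := by positivity
  have ha : 0 ≤ a := nonneg_of_mul_nonneg_left ((abs_nonneg _).trans hXU) hs2
  have hU : HasGaussianLaw U P := h.map (.snd ℝ _ _)
  have hV : HasGaussianLaw V P :=
    h.map ((ContinuousLinearMap.snd ℝ ℝ ℝ ∘L .snd ℝ ℝ (ℝ × ℝ)) ∘L .fst ℝ _ _)
  have hX : HasGaussianLaw X P := h.map ((ContinuousLinearMap.fst ℝ ℝ (ℝ × ℝ)) ∘L .fst ℝ _ _)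
  have hY : HasGaussianLaw Y P :=
    h.map ((ContinuousLinearMap.fst ℝ ℝ ℝ ∘L .snd ℝ ℝ (ℝ × ℝ)) ∘L .fst ℝ _ _)
  set p := (∫ ω, X ω * U ω ∂P) / s ^ 2 with hp
  set q := (∫ ω, Y ω * U ω ∂P) / s ^ 2 with hq
  set c := (∫ ω, V ω * U ω ∂P) / s ^ 2 with hc
  have hle : ∀ z : ℝ, |z| ≤ a * s ^ 2 → |z / s ^ 2| ≤ a := fun z hz => by
    rwa [abs_div, abs_of_pos hs2, div_le_iff₀ hs2]
  have hc1 : |c| ≤ 1 := by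
    rw [hc, abs_div, abs_of_pos hs2, div_le_one hs2]
    have i1 : Integrable (fun ω => V ω ^ 2 + U ω ^ 2) P :=
      hV.memLp_two.integrable_sq.add hU.memLp_two.integrable_sq
    have i2 : Integrable (fun ω => V ω * U ω) P := hV.memLp_two.integrable_mul hU.memLp_two
    have e : ∫ ω, (V ω ^ 2 + U ω ^ 2) ∂P = 2 * s ^ 2 := by
      rw [integral_add hV.memLp_two.integrable_sq hU.memLp_two.integrable_sq, hUs, hVs]; ring
    have j1 : ∫ ω, 2 * (V ω * U ω) ∂P ≤ ∫ ω, (V ω ^ 2 + U ω ^ 2) ∂P :=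
      integral_mono (i2.const_mul _) i1 fun ω => by
        simp only; nlinarith [sq_nonneg (V ω - U ω)]
    have j2 : ∫ ω, -(V ω ^ 2 + U ω ^ 2) ∂P ≤ ∫ ω, 2 * (V ω * U ω) ∂P :=
      integral_mono i1.neg (i2.const_mul _) fun ω => by
        simp only; nlinarith [sq_nonneg (V ω + U ω)]
    rw [integral_neg, integral_const_mul, e] at j2
    rw [integral_const_mul, e] at j1
    rw [abs_le]
    constructor <;> linarith
  have hG' : HasGaussianLaw
      (fun ω => ((X ω - p * U ω, Y ω - q * U ω, V ω - c * U ω), U ω)) P := by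
    let f1 := ContinuousLinearMap.fst ℝ (ℝ × ℝ × ℝ) ℝ
    let u := ContinuousLinearMap.snd ℝ (ℝ × ℝ × ℝ) ℝ
    exact h.map ((((ContinuousLinearMap.fst ℝ ℝ (ℝ × ℝ)) ∘L f1 - p • u).prod
      (((ContinuousLinearMap.fst ℝ ℝ ℝ ∘L .snd ℝ ℝ (ℝ × ℝ)) ∘L f1 - q • u).prod
        ((ContinuousLinearMap.snd ℝ ℝ ℝ ∘L .snd ℝ ℝ (ℝ × ℝ)) ∘L f1 - c • u))).prod u)
  have hcov : ∀ Z : Ω → ℝ, HasGaussianLaw Z P →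
      cov[fun ω => Z ω - (∫ ω, Z ω * U ω ∂P) / s ^ 2 * U ω, U; P] = 0 := by
    intro Z hZ
    have i1 : Integrable (fun ω => Z ω * U ω) P := hZ.memLp_two.integrable_mul hU.memLp_two
    rw [covariance_eq_sub (X := fun ω => Z ω - (∫ ω, Z ω * U ω ∂P) / s ^ 2 * U ω)
      (hZ.memLp_two.sub (hU.memLp_two.const_mul _)) hU.memLp_two, hU0, mul_zero, sub_zero]
    simp only [Pi.mul_apply, sub_mul]
    rw [integral_sub i1]
    · simp_rw [mul_assoc, ← sq]
      rw [integral_const_mul, hUs]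
      field_simp
      ring
    · simp_rw [mul_assoc, ← sq]
      exact hU.memLp_two.integrable_sq.const_mul _
  have hzero : ∫ ω, φ (X ω - p * U ω) * φ (Y ω - q * U ω) * (V ω - c * U ω) ^ 5 * U ω ^ 5 ∂P
      = 0 :=
    integral_mul_pow_five_eq_zero hG' hU0 (hcov X hX) (hcov Y hY) (hcov V hV)
      (F := fun z => φ z.1 * φ z.2.1 * z.2.2 ^ 5) (by fun_prop)
  have hint := integrable_mul_pow_five h hφ hM
  have hint' := integrable_mul_pow_five hG' hφ hM
  have hdom : Integrable (fun ω => a * (2 * L * M * (|U ω| ^ 11 + |V ω| ^ 11)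
      + 2560 * M ^ 2 * (|U ω| ^ 10 + |V ω| ^ 10))) P :=
    ((((integrable_abs_pow hU 11).add (integrable_abs_pow hV 11)).const_mul _).add
      (((integrable_abs_pow hU 10).add (integrable_abs_pow hV 10)).const_mul _)).const_mul _
  calc |∫ ω, φ (X ω) * φ (Y ω) * V ω ^ 5 * U ω ^ 5 ∂P|
      = |∫ ω, (φ (X ω) * φ (Y ω) * V ω ^ 5 * U ω ^ 5 -
          φ (X ω - p * U ω) * φ (Y ω - q * U ω) * (V ω - c * U ω) ^ 5 * U ω ^ 5) ∂P| := by
        rw [integral_sub hint hint', hzero, sub_zero]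
    _ ≤ ∫ ω, a * (2 * L * M * (|U ω| ^ 11 + |V ω| ^ 11)
          + 2560 * M ^ 2 * (|U ω| ^ 10 + |V ω| ^ 10)) ∂P := by
        refine abs_integral_le_integral_abs.trans
          (integral_mono (hint.sub hint').abs hdom fun ω => ?_)
        exact abs_mul_pow_five_sub_le hM hL0 hL (hle _ hXU) (hle _ hYU) (hle _ hVU) hc1 _ _ _ _
    _ = a * (4 * L * M * absMoment 11 * s ^ 11 + 5120 * M ^ 2 * absMoment 10 * s ^ 10) := by
        rw [integral_const_mul, integral_add, integral_const_mul, integral_const_mul,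
          integral_add (integrable_abs_pow hU 11) (integrable_abs_pow hV 11),
          integral_add (integrable_abs_pow hU 10) (integrable_abs_pow hV 10),
          integral_abs_pow hU hU0 hs.le hUs, integral_abs_pow hV hV0 hs.le hVs,
          integral_abs_pow hU hU0 hs.le hUs, integral_abs_pow hV hV0 hs.le hVs]
        · ring
        · exact ((integrable_abs_pow hU 11).add (integrable_abs_pow hV 11)).const_mul _
        · exact ((integrable_abs_pow hU 10).add (integrable_abs_pow hV 10)).const_mul _
    _ ≤ a * (decorConst L M * s ^ 10) := by
        have h11 : s ^ 11 ≤ s ^ 10 := pow_le_pow_of_le_one hs.le hs1 (by norm_num)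
        have := absMoment_nonneg 11
        rw [decorConst, add_mul]
        gcongr

end Gaussian

section CubeRoot

/-- The increasing branch of the cube root on the real line. -/
def signedCbrt (x : ℝ) : ℝ :=
  if 0 ≤ x then x ^ ((1 : ℝ) / 3) else -(-x) ^ ((1 : ℝ) / 3)

lemma abs_signedCbrt (x : ℝ) : |signedCbrt x| = |x| ^ ((1 : ℝ) / 3) := by
  unfold signedCbrt
  split_ifs with h
  · rw [abs_of_nonneg (by positivity), abs_of_nonneg h]
  · rw [abs_neg, abs_of_neg (not_le.1 h), abs_of_nonneg]
    have : 0 ≤ -x := by linarith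
    positivity

lemma signedCbrt_zero : signedCbrt 0 = 0 := by simp [signedCbrt]

lemma monotone_signedCbrt : Monotone signedCbrt := by
  intro x y hxy
  unfold signedCbrt
  split_ifs with hx hy hy
  · exact Real.rpow_le_rpow hx hxy (by norm_num)
  · exact absurd (hx.trans hxy) hy
  · have h1 : 0 ≤ (-x) ^ ((1 : ℝ) / 3) := Real.rpow_nonneg (by linarith) _
    have h2 : 0 ≤ y ^ ((1 : ℝ) / 3) := Real.rpow_nonneg hy _
    linarith
  · exact neg_le_neg (Real.rpow_le_rpow (by linarith) (by linarith) (by norm_num))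

/-- The increment of `signedCbrt` over the unit interval ending at `x`. -/
def cbrtStep (x : ℝ) : ℝ := signedCbrt x - signedCbrt (x - 1)

lemma cbrtStep_nonneg (x : ℝ) : 0 ≤ cbrtStep x :=
  sub_nonneg.2 (monotone_signedCbrt (by linarith))

lemma abs_rpow_sub_le_cbrtStep (x : ℝ) :
    |(|x| ^ ((1 : ℝ) / 3) - |x - 1| ^ ((1 : ℝ) / 3))| ≤ cbrtStep x := by
  rw [← abs_signedCbrt, ← abs_signedCbrt]
  exact (abs_abs_sub_abs_le_abs_sub _ _).trans_eq (abs_of_nonneg (cbrtStep_nonneg x))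

lemma sum_Icc_sub_pred (F : ℝ → ℝ) (k : ℕ) :
    ∑ j ∈ Finset.Icc 1 k, (F j - F ((j : ℝ) - 1)) = F k - F 0 := by
  induction k with
  | zero => simp
  | succ k ih =>
    rw [Finset.sum_Icc_succ_top (by omega), ih]
    push_cast
    rw [add_sub_cancel_right]
    ring

lemma signedCbrt_sub_le {k : ℕ} {x y : ℝ} (hx : |x| ≤ k) (hy : |y| ≤ k) :
    signedCbrt x - signedCbrt y ≤ 2 * (k : ℝ) ^ ((1 : ℝ) / 3) := by
  have h : ∀ z : ℝ, |z| ≤ k → |signedCbrt z| ≤ (k : ℝ) ^ ((1 : ℝ) / 3) := fun z hz => by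
    rw [abs_signedCbrt]
    exact Real.rpow_le_rpow (abs_nonneg _) hz (by norm_num)
  linarith [(abs_le.1 (h x hx)).2, (abs_le.1 (h y hy)).1]

/-- A bound for the correlations of the `i`-th increment with the increment and the midpoint over
the `j`-th interval. -/
def corrBound (i j : ℕ) : ℝ := cbrtStep i + cbrtStep (i - j) + cbrtStep (i - j + 1)

lemma sum_corrBound_le (k : ℕ) :
    ∑ i ∈ Finset.Icc 1 k, ∑ j ∈ Finset.Icc 1 k, corrBound i j ≤
      5 * (k * (k : ℝ) ^ ((1 : ℝ) / 3)) := by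
  have hpow : 0 ≤ (k : ℝ) ^ ((1 : ℝ) / 3) := by positivity
  have h1 : ∑ i ∈ Finset.Icc 1 k, ∑ _j ∈ Finset.Icc 1 k, cbrtStep i =
      k * (k : ℝ) ^ ((1 : ℝ) / 3) := by
    simp_rw [Finset.sum_const, Nat.card_Icc, nsmul_eq_mul]
    rw [← Finset.mul_sum]
    unfold cbrtStep
    rw [sum_Icc_sub_pred, signedCbrt_zero]
    simp [signedCbrt]
  have h2 : ∀ i ∈ Finset.Icc 1 k, ∑ j ∈ Finset.Icc 1 k, cbrtStep ((i : ℝ) - j) ≤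
      2 * (k : ℝ) ^ ((1 : ℝ) / 3) := by
    intro i hi
    have hi := Finset.mem_Icc.1 hi
    have e : ∀ j : ℕ, cbrtStep ((i : ℝ) - j) =
        (fun x : ℝ => -signedCbrt (i - 1 - x)) j
          - (fun x : ℝ => -signedCbrt (i - 1 - x)) (j - 1) := by
      intro j
      simp only [cbrtStep]
      rw [show (i : ℝ) - 1 - (j - 1) = i - j by ring, show (i : ℝ) - j - 1 = i - 1 - j by ring]
      ring
    rw [(Finset.sum_congr rfl fun j _ => e j).trans
      (sum_Icc_sub_pred (fun x : ℝ => -signedCbrt (i - 1 - x)) k)]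
    have c1 : (1 : ℝ) ≤ i := by exact_mod_cast hi.1
    have c2 : (i : ℝ) ≤ k := by exact_mod_cast hi.2
    refine le_trans (le_of_eq ?_) (signedCbrt_sub_le (x := (i : ℝ) - 1) (y := (i : ℝ) - 1 - k)
      (by rw [abs_le]; constructor <;> linarith) (by rw [abs_le]; constructor <;> linarith))
    simp only [sub_zero]
    ring
  have h3 : ∀ i ∈ Finset.Icc 1 k, ∑ j ∈ Finset.Icc 1 k, cbrtStep ((i : ℝ) - j + 1) ≤
      2 * (k : ℝ) ^ ((1 : ℝ) / 3) := by
    intro i hi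
    have hi := Finset.mem_Icc.1 hi
    have e : ∀ j : ℕ, cbrtStep ((i : ℝ) - j + 1) =
        (fun x : ℝ => -signedCbrt (i - x)) j - (fun x : ℝ => -signedCbrt (i - x)) (j - 1) := by
      intro j
      simp only [cbrtStep]
      rw [show (i : ℝ) - (j - 1) = i - j + 1 by ring, add_sub_cancel_right]
      ring
    rw [(Finset.sum_congr rfl fun j _ => e j).trans
      (sum_Icc_sub_pred (fun x : ℝ => -signedCbrt (i - x)) k)]
    have c1 : (1 : ℝ) ≤ i := by exact_mod_cast hi.1
    have c2 : (i : ℝ) ≤ k := by exact_mod_cast hi.2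
    refine le_trans (le_of_eq ?_) (signedCbrt_sub_le (x := (i : ℝ)) (y := (i : ℝ) - k)
      (by rw [abs_le]; constructor <;> linarith) (by rw [abs_le]; constructor <;> linarith))
    simp only [sub_zero]
    ring
  unfold corrBound
  simp_rw [Finset.sum_add_distrib]
  have g2 := Finset.sum_le_sum h2
  have g3 := Finset.sum_le_sum h3
  rw [Finset.sum_const, Nat.card_Icc, nsmul_eq_mul, Nat.add_sub_cancel] at g2 g3
  rw [h1]
  linarith

end CubeRoot

namespace IsFBM16

variable {Ω : Type*} [MeasureSpace Ω] {B : ℝ → Ω → ℝ}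

lemma hasGaussianLaw_pi (hB : IsFBM16 B) {m : ℕ} {t : Fin m → ℝ} (ht : ∀ i, 0 ≤ t i) :
    HasGaussianLaw (fun ω i => B (t i) ω) volume where
  isGaussian_map := by
    have hmeas : Measurable fun ω i => B (t i) ω := measurable_pi_lambda _ fun i => hB.1 _
    refine isGaussian_of_map_eq_gaussianReal fun L => ?_
    obtain ⟨v, hv⟩ := hB.2.2.1 m t (fun i => L (Pi.single i 1)) ht
    have e : (L ∘ fun ω i => B (t i) ω) = fun ω => ∑ i, L (Pi.single i 1) * B (t i) ω := by
      ext ω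
      simp only [Function.comp_apply]
      conv_lhs => rw [← ContinuousLinearMap.coe_coe, LinearMap.pi_apply_eq_sum_univ]
      refine Finset.sum_congr rfl fun i _ => ?_
      have : (fun j => if i = j then (1 : ℝ) else 0) = Pi.single i 1 := by
        ext j
        simp [Pi.single_apply, eq_comm]
      rw [smul_eq_mul, mul_comm, this]
      rfl
    exact ⟨0, v, by rw [Measure.map_map (by fun_prop) hmeas, e, hv]⟩

lemma hasGaussianLaw (hB : IsFBM16 B) {t : ℝ} (ht : 0 ≤ t) : HasGaussianLaw (B t) volume :=
  (hB.hasGaussianLaw_pi (m := 1) (t := fun _ => t) fun _ => ht).map (.proj 0)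

lemma integral_eq_zero (hB : IsFBM16 B) {t : ℝ} (ht : 0 ≤ t) : ∫ ω, B t ω = 0 := by
  obtain ⟨v, hv⟩ := hB.2.2.1 1 (fun _ => t) (fun _ => 1) fun _ => ht
  simp only [Finset.univ_unique, Finset.sum_const, Finset.card_singleton, one_smul, one_mul] at hv
  have : ∫ x, x ∂(Measure.map (fun ω => B t ω) (volume : Measure Ω)) = 0 := by
    rw [hv, integral_id_gaussianReal]
  rwa [integral_map (hB.1 t).aemeasurable (by fun_prop)] at this

lemma hasGaussianLaw_quadruple (hB : IsFBM16 B) {p q u v : ℝ} (hp : 0 ≤ p) (hq : 0 ≤ q)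
    (hu : 0 ≤ u) (hv : 0 ≤ v) :
    HasGaussianLaw (fun ω => (((B u ω + B v ω) / 2, (B p ω + B q ω) / 2, B q ω - B p ω),
      B v ω - B u ω)) volume := by
  have h := hB.hasGaussianLaw_pi (m := 4) (t := ![p, q, u, v])
    (by intro i; fin_cases i <;> simpa)
  let e (i : Fin 4) : (Fin 4 → ℝ) →L[ℝ] ℝ := .proj i
  have h' := h.map_fun (((((1 / 2 : ℝ) • (e 2 + e 3)).prod
    (((1 / 2 : ℝ) • (e 0 + e 1)).prod (e 1 - e 0)))).prod (e 3 - e 2))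
  refine h'.congr (ae_of_all _ fun ω => ?_)
  simp only [e, ContinuousLinearMap.prod_apply, smul_apply, add_apply, sub_apply,
    ContinuousLinearMap.proj_apply, smul_eq_mul]
  simp [div_eq_inv_mul]

lemma integrable_mul (hB : IsFBM16 B) {s t : ℝ} (hs : 0 ≤ s) (ht : 0 ≤ t) :
    Integrable (fun ω => B s ω * B t ω) :=
  (hB.hasGaussianLaw hs).memLp_two.integrable_mul (hB.hasGaussianLaw ht).memLp_two

lemma integral_mul_sub (hB : IsFBM16 B) {t u v : ℝ} (ht : 0 ≤ t) (hu : 0 ≤ u) (hv : 0 ≤ v) :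
    ∫ ω, B t ω * (B v ω - B u ω) =
      (v ^ ((1 : ℝ) / 3) - u ^ ((1 : ℝ) / 3) + |t - u| ^ ((1 : ℝ) / 3)
        - |t - v| ^ ((1 : ℝ) / 3)) / 2 := by
  simp_rw [mul_sub]
  rw [integral_sub (hB.integrable_mul ht hv) (hB.integrable_mul ht hu), hB.2.2.2 _ _ ht hv,
    hB.2.2.2 _ _ ht hu, abs_sub_comm v t, abs_sub_comm u t,
    abs_sub_comm t v, abs_sub_comm t u]
  ring

end IsFBM16

/-- The typical size `n ^ (-1/6)` of an increment over an interval of length `1 / n`. -/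
def incScale (n : ℕ) : ℝ := (n : ℝ) ^ (-(1 / 6) : ℝ)

lemma incScale_pos {n : ℕ} (hn : 0 < n) : 0 < incScale n :=
  Real.rpow_pos_of_pos (by exact_mod_cast hn) _

lemma incScale_le_one {n : ℕ} (hn : 0 < n) : incScale n ≤ 1 :=
  Real.rpow_le_one_of_one_le_of_nonpos (by exact_mod_cast hn) (by norm_num)

lemma incScale_pow (n p : ℕ) : incScale n ^ p = (n : ℝ) ^ (-(p / 6) : ℝ) := by
  rw [incScale, ← Real.rpow_natCast, ← Real.rpow_mul (Nat.cast_nonneg n)]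
  congr 1
  ring

lemma abs_div_rpow (x : ℝ) (n : ℕ) :
    |x / n| ^ ((1 : ℝ) / 3) = |x| ^ ((1 : ℝ) / 3) * incScale n ^ 2 := by
  rw [abs_div, Nat.abs_cast, Real.div_rpow (abs_nonneg _) (Nat.cast_nonneg n), incScale_pow,
    div_eq_mul_inv, ← Real.rpow_neg (Nat.cast_nonneg n)]
  norm_num

section Increments

variable {Ω : Type*}

/-- The increment of `B` over the `j`-th interval of the mesh of size `1 / n`. -/
def meshInc (B : ℝ → Ω → ℝ) (n j : ℕ) (ω : Ω) : ℝ :=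
  B ((j : ℝ) / n) ω - B (((j : ℝ) - 1) / n) ω

/-- The mean of `B` at the end points of the `j`-th interval of the mesh of size `1 / n`. -/
def meshMid (B : ℝ → Ω → ℝ) (n j : ℕ) (ω : Ω) : ℝ :=
  (B (((j : ℝ) - 1) / n) ω + B ((j : ℝ) / n) ω) / 2

end Increments

namespace IsFBM16

variable {Ω : Type*} [MeasureSpace Ω] {B : ℝ → Ω → ℝ}

lemma left_nonneg {n j : ℕ} (hj : 1 ≤ j) : 0 ≤ ((j : ℝ) - 1) / n :=
  div_nonneg (sub_nonneg.2 (by exact_mod_cast hj)) (Nat.cast_nonneg n)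

lemma right_nonneg (n j : ℕ) : 0 ≤ (j : ℝ) / n := by positivity

lemma hasGaussianLaw_mesh (hB : IsFBM16 B) (n : ℕ) {i j : ℕ} (hi : 1 ≤ i) (hj : 1 ≤ j) :
    HasGaussianLaw (fun ω => ((meshMid B n i ω, meshMid B n j ω, meshInc B n j ω),
      meshInc B n i ω)) volume :=
  hB.hasGaussianLaw_quadruple (left_nonneg hj) (right_nonneg n j) (left_nonneg hi)
    (right_nonneg n i)

lemma hasGaussianLaw_meshInc (hB : IsFBM16 B) (n : ℕ) {i : ℕ} (hi : 1 ≤ i) :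
    HasGaussianLaw (meshInc B n i) volume :=
  (hB.hasGaussianLaw_mesh n hi hi).map (.snd ℝ _ _)

lemma integral_meshInc (hB : IsFBM16 B) (n : ℕ) {i : ℕ} (hi : 1 ≤ i) :
    ∫ ω, meshInc B n i ω = 0 := by
  unfold meshInc
  rw [integral_sub (hB.hasGaussianLaw (right_nonneg n i)).integrable
    (hB.hasGaussianLaw (left_nonneg hi)).integrable, hB.integral_eq_zero (right_nonneg n i),
    hB.integral_eq_zero (left_nonneg hi), sub_zero]

lemma integrable_mul_meshInc (hB : IsFBM16 B) (n : ℕ) {t : ℝ} (ht : 0 ≤ t) {i : ℕ} (hi : 1 ≤ i) :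
    Integrable (fun ω => B t ω * meshInc B n i ω) :=
  (hB.hasGaussianLaw ht).memLp_two.integrable_mul (hB.hasGaussianLaw_meshInc n hi).memLp_two

lemma integral_mul_meshInc (hB : IsFBM16 B) (n : ℕ) {x : ℝ} (hx : 0 ≤ x) {i : ℕ} (hi : 1 ≤ i) :
    ∫ ω, B (x / n) ω * meshInc B n i ω =
      (|(i : ℝ)| ^ ((1 : ℝ) / 3) - |(i : ℝ) - 1| ^ ((1 : ℝ) / 3)
        + |(i : ℝ) - x - 1| ^ ((1 : ℝ) / 3) - |(i : ℝ) - x| ^ ((1 : ℝ) / 3)) / 2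
        * incScale n ^ 2 := by
  unfold meshInc
  rw [hB.integral_mul_sub (div_nonneg hx (Nat.cast_nonneg n)) (left_nonneg hi) (right_nonneg n i),
    ← sub_div, ← sub_div, ← abs_of_nonneg (right_nonneg n i), ← abs_of_nonneg (left_nonneg hi),
    abs_div_rpow, abs_div_rpow, abs_div_rpow, abs_div_rpow, abs_sub_comm x i,
    show x - ((i : ℝ) - 1) = -((i : ℝ) - x - 1) by ring, abs_neg]
  ring

lemma integral_meshInc_sq (hB : IsFBM16 B) (n : ℕ) {i : ℕ} (hi : 1 ≤ i) :
    ∫ ω, meshInc B n i ω ^ 2 = incScale n ^ 2 := by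
  have h1 : (0 : ℝ) ≤ (i : ℝ) - 1 := sub_nonneg.2 (by exact_mod_cast hi)
  have e : ∀ ω, meshInc B n i ω ^ 2 = B ((i : ℝ) / n) ω * meshInc B n i ω
      - B (((i : ℝ) - 1) / n) ω * meshInc B n i ω := fun ω => by
    simp only [meshInc]; ring
  simp_rw [e]
  rw [integral_sub (hB.integrable_mul_meshInc n (right_nonneg n i) hi)
    (hB.integrable_mul_meshInc n (left_nonneg hi) hi), hB.integral_mul_meshInc n i.cast_nonneg hi,
    hB.integral_mul_meshInc n h1 hi]
  norm_num
  ring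

lemma integral_abs_meshInc_pow [IsProbabilityMeasure (volume : Measure Ω)] (hB : IsFBM16 B)
    {n : ℕ} (hn : 0 < n) {i : ℕ} (hi : 1 ≤ i) (p : ℕ) :
    ∫ ω, |meshInc B n i ω| ^ p = absMoment p * incScale n ^ p :=
  integral_abs_pow (hB.hasGaussianLaw_meshInc n hi) (hB.integral_meshInc n hi)
    (incScale_pos hn).le (hB.integral_meshInc_sq n hi) p

lemma abs_integral_mul_meshInc_le (hB : IsFBM16 B) (n : ℕ) {x : ℝ} (hx : 0 ≤ x) {i : ℕ}
    (hi : 1 ≤ i) :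
    |∫ ω, B (x / n) ω * meshInc B n i ω| ≤
      (cbrtStep i + cbrtStep (i - x)) / 2 * incScale n ^ 2 := by
  rw [hB.integral_mul_meshInc n hx hi, abs_mul, abs_of_nonneg (sq_nonneg (incScale n))]
  gcongr
  have h1 := abs_le.1 (abs_rpow_sub_le_cbrtStep (i : ℝ))
  have h2 := abs_le.1 (abs_rpow_sub_le_cbrtStep ((i : ℝ) - x))
  rw [abs_le]
  constructor <;> linarith [h1.1, h1.2, h2.1, h2.2]

lemma abs_integral_meshMid_self_le (hB : IsFBM16 B) (n : ℕ) {i : ℕ} (hi : 1 ≤ i) :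
    |∫ ω, meshMid B n i ω * meshInc B n i ω| ≤ cbrtStep i * incScale n ^ 2 := by
  have h1 : (0 : ℝ) ≤ (i : ℝ) - 1 := sub_nonneg.2 (by exact_mod_cast hi)
  have e : ∀ ω, meshMid B n i ω * meshInc B n i ω =
      (B (((i : ℝ) - 1) / n) ω * meshInc B n i ω
        + B ((i : ℝ) / n) ω * meshInc B n i ω) / 2 := fun ω => by
    simp only [meshMid]; ring
  simp_rw [e]
  rw [integral_div, integral_add (hB.integrable_mul_meshInc n (left_nonneg hi) hi)
    (hB.integrable_mul_meshInc n (right_nonneg n i) hi),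
    hB.integral_mul_meshInc n i.cast_nonneg hi, hB.integral_mul_meshInc n h1 hi]
  have h2 := abs_rpow_sub_le_cbrtStep (i : ℝ)
  have e2 : (i : ℝ) - (i - 1) - 1 = 0 := by ring
  have e3 : (i : ℝ) - (i - 1) = 1 := by ring
  rw [e2, e3, sub_self, zero_sub, abs_neg]
  rw [← add_mul, mul_div_right_comm, abs_mul, abs_of_nonneg (sq_nonneg (incScale n))]
  gcongr
  have h3 := cbrtStep_nonneg i
  rw [abs_le] at h2 ⊢
  constructor <;> linarith [h2.1, h2.2]

lemma abs_integral_meshMid_le (hB : IsFBM16 B) (n : ℕ) {i j : ℕ} (hi : 1 ≤ i) (hj : 1 ≤ j) :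
    |∫ ω, meshMid B n j ω * meshInc B n i ω| ≤ corrBound i j * incScale n ^ 2 := by
  have h1 : (0 : ℝ) ≤ (j : ℝ) - 1 := sub_nonneg.2 (by exact_mod_cast hj)
  have e : ∀ ω, meshMid B n j ω * meshInc B n i ω =
      (B (((j : ℝ) - 1) / n) ω * meshInc B n i ω
        + B ((j : ℝ) / n) ω * meshInc B n i ω) / 2 := fun ω => by
    simp only [meshMid]; ring
  simp_rw [e]
  rw [integral_div, integral_add (hB.integrable_mul_meshInc n (left_nonneg hj) hi)
    (hB.integrable_mul_meshInc n (right_nonneg n j) hi)]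
  have a1 := abs_le.1 (hB.abs_integral_mul_meshInc_le n h1 hi)
  have a2 := abs_le.1 (hB.abs_integral_mul_meshInc_le n j.cast_nonneg hi)
  rw [show (i : ℝ) - (j - 1) = i - j + 1 by ring] at a1
  have b1 := mul_nonneg (cbrtStep_nonneg (i - j)) (sq_nonneg (incScale n))
  have b2 := mul_nonneg (cbrtStep_nonneg (i - j + 1)) (sq_nonneg (incScale n))
  have b3 := mul_nonneg (cbrtStep_nonneg i) (sq_nonneg (incScale n))
  unfold corrBound
  rw [abs_le]
  constructor <;> linarith [a1.1, a1.2, a2.1, a2.2]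

lemma abs_integral_meshInc_mul_le (hB : IsFBM16 B) (n : ℕ) {i j : ℕ} (hi : 1 ≤ i) (hj : 1 ≤ j) :
    |∫ ω, meshInc B n j ω * meshInc B n i ω| ≤ corrBound i j * incScale n ^ 2 := by
  have h1 : (0 : ℝ) ≤ (j : ℝ) - 1 := sub_nonneg.2 (by exact_mod_cast hj)
  have e : ∀ ω, meshInc B n j ω * meshInc B n i ω =
      B ((j : ℝ) / n) ω * meshInc B n i ω
        - B (((j : ℝ) - 1) / n) ω * meshInc B n i ω := fun ω => by
    simp only [meshInc]; ring
  simp_rw [e]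
  rw [integral_sub (hB.integrable_mul_meshInc n (right_nonneg n j) hi)
    (hB.integrable_mul_meshInc n (left_nonneg hj) hi)]
  have a1 := abs_le.1 (hB.abs_integral_mul_meshInc_le n h1 hi)
  have a2 := abs_le.1 (hB.abs_integral_mul_meshInc_le n j.cast_nonneg hi)
  rw [show (i : ℝ) - (j - 1) = i - j + 1 by ring] at a1
  have b1 := mul_nonneg (cbrtStep_nonneg (i - j)) (sq_nonneg (incScale n))
  have b2 := mul_nonneg (cbrtStep_nonneg (i - j + 1)) (sq_nonneg (incScale n))
  have b3 := mul_nonneg (cbrtStep_nonneg i) (sq_nonneg (incScale n))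
  unfold corrBound
  rw [abs_le]
  constructor <;> linarith [a1.1, a1.2, a2.1, a2.2]

variable {φ : ℝ → ℝ} {M L : ℝ}

lemma integrable_sum_sq (hB : IsFBM16 B) (hφ : Continuous φ) (hM : ∀ x, |φ x| ≤ M) (n k : ℕ) :
    Integrable fun ω => (∑ j ∈ Finset.Icc 1 k, φ (meshMid B n j ω) * meshInc B n j ω ^ 5) ^ 2 := by
  simp_rw [sq, Finset.sum_mul_sum]
  refine integrable_finsetSum _ fun i hi => integrable_finsetSum _ fun j hj => ?_
  refine (integrable_mul_pow_five (hB.hasGaussianLaw_mesh n (Finset.mem_Icc.1 hi).1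
    (Finset.mem_Icc.1 hj).1) hφ hM).congr (ae_of_all _ fun ω => ?_)
  simp only
  ring

lemma integral_sum_sq_le (hB : IsFBM16 B) (hφ : Continuous φ) (hM : ∀ x, |φ x| ≤ M) (hL0 : 0 ≤ L)
    (hL : ∀ x y, |φ x - φ y| ≤ L * |x - y|) {n : ℕ} (hn : 0 < n) (k : ℕ) :
    ∫ ω, (∑ j ∈ Finset.Icc 1 k, φ (meshMid B n j ω) * meshInc B n j ω ^ 5) ^ 2 ≤
      5 * (k * (k : ℝ) ^ ((1 : ℝ) / 3)) * (decorConst L M * incScale n ^ 10) := by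
  have hM0 : 0 ≤ M := (abs_nonneg _).trans (hM 0)
  have e : ∀ ω, (∑ j ∈ Finset.Icc 1 k, φ (meshMid B n j ω) * meshInc B n j ω ^ 5) ^ 2 =
      ∑ i ∈ Finset.Icc 1 k, ∑ j ∈ Finset.Icc 1 k, φ (meshMid B n i ω) * φ (meshMid B n j ω)
        * meshInc B n j ω ^ 5 * meshInc B n i ω ^ 5 := fun ω => by
    rw [sq, Finset.sum_mul_sum]
    refine Finset.sum_congr rfl fun i _ => Finset.sum_congr rfl fun j _ => ?_
    ring
  have hint : ∀ i ∈ Finset.Icc 1 k, ∀ j ∈ Finset.Icc 1 k,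
      Integrable fun ω => φ (meshMid B n i ω) * φ (meshMid B n j ω)
        * meshInc B n j ω ^ 5 * meshInc B n i ω ^ 5 := fun i hi j hj =>
    integrable_mul_pow_five (hB.hasGaussianLaw_mesh n (Finset.mem_Icc.1 hi).1
      (Finset.mem_Icc.1 hj).1) hφ hM
  simp_rw [e]
  rw [integral_finsetSum _ fun i hi => integrable_finsetSum _ (hint i hi)]
  calc ∑ i ∈ Finset.Icc 1 k, ∫ ω, ∑ j ∈ Finset.Icc 1 k, φ (meshMid B n i ω)
          * φ (meshMid B n j ω) * meshInc B n j ω ^ 5 * meshInc B n i ω ^ 5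
      ≤ ∑ i ∈ Finset.Icc 1 k, ∑ j ∈ Finset.Icc 1 k,
          corrBound i j * (decorConst L M * incScale n ^ 10) := by
        refine Finset.sum_le_sum fun i hi => ?_
        rw [integral_finsetSum _ (hint i hi)]
        refine Finset.sum_le_sum fun j hj => (le_abs_self _).trans ?_
        have hi := (Finset.mem_Icc.1 hi).1
        have hj := (Finset.mem_Icc.1 hj).1
        refine abs_integral_mul_pow_five_le (hB.hasGaussianLaw_mesh n hi hj)
          (hB.integral_meshInc n hi) (hB.integral_meshInc n hj) (incScale_pos hn)
          (hB.integral_meshInc_sq n hi) (hB.integral_meshInc_sq n hj)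
          ((hB.abs_integral_meshMid_self_le n hi).trans ?_) (hB.abs_integral_meshMid_le n hi hj)
          (hB.abs_integral_meshInc_mul_le n hi hj) hφ hM hL0 hL (incScale_le_one hn)
        gcongr
        unfold corrBound
        linarith [cbrtStep_nonneg ((i : ℝ) - j), cbrtStep_nonneg ((i : ℝ) - j + 1)]
    _ = (∑ i ∈ Finset.Icc 1 k, ∑ j ∈ Finset.Icc 1 k, corrBound i j)
          * (decorConst L M * incScale n ^ 10) := by
        simp_rw [Finset.sum_mul]
    _ ≤ _ := by
        have := decorConst_nonneg hL0 hM0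
        have := incScale_pos hn
        exact mul_le_mul_of_nonneg_right (sum_corrBound_le k) (by positivity)

end IsFBM16

section Taylor

/-- Taylor's theorem with a remainder that is uniform on a compact interval. -/
lemma exists_taylor_remainder {u : ℝ → ℝ} (hu : ContDiff ℝ (⊤ : ℕ∞) u) (K : ℝ) (N : ℕ) :
    ∃ C : ℝ, ∀ x ∈ Set.Icc (-K) K, ∀ y ∈ Set.Icc (-K) K, ∃ r : ℝ, |r| ≤ C ∧
      u y = ∑ k ∈ Finset.range (N + 1), iteratedDeriv k u x / k.factorial * (y - x) ^ k
        + r * (y - x) ^ (N + 1) := by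
  obtain ⟨C, hC⟩ := (isCompact_Icc (a := -K) (b := K)).exists_bound_of_continuousOn
    (hu.continuous_iteratedDeriv (N + 1) (by exact_mod_cast le_top)).continuousOn
  refine ⟨C / (N + 1).factorial, fun x hx y hy => ?_⟩
  have hC0 : 0 ≤ C := (norm_nonneg _).trans (hC x hx)
  rcases eq_or_ne x y with rfl | hxy
  · refine ⟨0, by simpa using by positivity, ?_⟩
    rw [Finset.sum_range_succ', Finset.sum_eq_zero fun k _ => by simp]
    simp
  · have hu' : ContDiff ℝ (N + 1 : ℕ) u := hu.of_le (by exact_mod_cast le_top)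
    obtain ⟨z, hz, h⟩ := taylor_mean_remainder_lagrange_iteratedDeriv (n := N) hxy
      (by exact_mod_cast hu'.contDiffOn)
    refine ⟨iteratedDeriv (N + 1) u z / (N + 1).factorial, ?_, ?_⟩
    · rw [abs_div, Nat.abs_cast]
      gcongr
      exact hC z (Set.uIcc_subset_Icc hx hy (Set.Ioo_subset_Icc_self hz))
    · rw [sub_eq_iff_eq_add'] at h
      rw [h, taylor_within_apply]
      congr 1
      · refine Finset.sum_congr rfl fun k hk => ?_
        rw [iteratedDerivWithin_eq_iteratedDeriv (uniqueDiffOn_uIcc hxy)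
          (hu.of_le (by exact_mod_cast le_top)).contDiffAt Set.left_mem_uIcc, smul_eq_mul]
        ring
      · ring

/-- Expansion of `A D ^ 3` for two polynomials in `x` up to the order `x ^ 2`. -/
lemma exists_abs_mul_cube_sub_le (M : ℝ) : ∃ C : ℝ, ∀ a₀ a₁ a₂ d₀ d₁ d₂ x : ℝ,
    |a₀| ≤ M → |a₁| ≤ M → |a₂| ≤ M → |d₀| ≤ M → |d₁| ≤ M → |d₂| ≤ M → |x| ≤ M →
    |(a₀ + a₁ * x + a₂ * x ^ 2) * (d₀ + d₁ * x + d₂ * x ^ 2) ^ 3 - a₀ * d₀ ^ 3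
      - (3 * a₀ * d₀ ^ 2 * d₁ + a₁ * d₀ ^ 3) * x| ≤ C * x ^ 2 := by
  let Q : ℝ × ℝ × ℝ × ℝ × ℝ × ℝ × ℝ → ℝ := fun ⟨a₀, a₁, a₂, d₀, d₁, d₂, x⟩ =>
    a₀ * (3 * d₀ ^ 2 * d₂ + 3 * d₀ * (d₁ + d₂ * x) ^ 2 + x * (d₁ + d₂ * x) ^ 3)
      + a₁ * (d₁ + d₂ * x) * ((d₀ + d₁ * x + d₂ * x ^ 2) ^ 2
        + (d₀ + d₁ * x + d₂ * x ^ 2) * d₀ + d₀ ^ 2)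
      + a₂ * (d₀ + d₁ * x + d₂ * x ^ 2) ^ 3
  have hQ : Continuous Q := by fun_prop
  obtain ⟨C, hC⟩ := (isCompact_closedBall (0 : ℝ × ℝ × ℝ × ℝ × ℝ × ℝ × ℝ) M)
    |>.exists_bound_of_continuousOn hQ.continuousOn
  refine ⟨C, fun a₀ a₁ a₂ d₀ d₁ d₂ x h1 h2 h3 h4 h5 h6 h7 => ?_⟩
  have h := hC (a₀, a₁, a₂, d₀, d₁, d₂, x) (by
    rw [mem_closedBall_zero_iff]
    simp only [Prod.norm_mk, Real.norm_eq_abs, sup_le_iff]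
    exact ⟨h1, h2, h3, h4, h5, h6, h7⟩)
  calc _ = |Q (a₀, a₁, a₂, d₀, d₁, d₂, x) * x ^ 2| := by
        congr 1
        simp only [Q]
        ring
    _ = |Q (a₀, a₁, a₂, d₀, d₁, d₂, x)| * x ^ 2 := by rw [abs_mul, abs_of_nonneg (sq_nonneg x)]
    _ ≤ C * x ^ 2 := by gcongr; exact h

/-- The coefficient of `(b - a) ^ 5` in the expansion of `(f a + f b) / 2 * (g b - g a) ^ 3` at the
mid-point of `a` and `b`. -/
def quinticCoeff (f g : ℝ → ℝ) (x : ℝ) : ℝ :=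
  (f x * iteratedDeriv 1 g x ^ 2 * iteratedDeriv 3 g x
    + iteratedDeriv 2 f x * iteratedDeriv 1 g x ^ 3) / 8

lemma contDiff_quinticCoeff {f g : ℝ → ℝ} (hf : ContDiff ℝ (⊤ : ℕ∞) f)
    (hg : ContDiff ℝ (⊤ : ℕ∞) g) : ContDiff ℝ 1 (quinticCoeff f g) := by
  have h (u : ℝ → ℝ) (hu : ContDiff ℝ (⊤ : ℕ∞) u) (k : ℕ) : ContDiff ℝ 1 (iteratedDeriv k u) := by
    rw [iteratedDeriv_eq_iterate]
    exact ContDiff.iterate_deriv' 1 k (hu.of_le (by exact_mod_cast le_top))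
  have h0 : ContDiff ℝ 1 f := hf.of_le (by exact_mod_cast le_top)
  exact (((h0.mul ((h g hg 1).pow 2)).mul (h g hg 3)).add
    ((h f hf 2).mul ((h g hg 1).pow 3))).div_const 8

lemma exists_abs_trapezoid_mul_cube_sub_le {f g : ℝ → ℝ} (hf : ContDiff ℝ (⊤ : ℕ∞) f)
    (hg : ContDiff ℝ (⊤ : ℕ∞) g) (K : ℝ) : ∃ C : ℝ, 0 ≤ C ∧
    ∀ a ∈ Set.Icc (-K) K, ∀ b ∈ Set.Icc (-K) K,
    |(f a + f b) / 2 * (g b - g a) ^ 3 - f ((a + b) / 2) * deriv g ((a + b) / 2) ^ 3 * (b - a) ^ 3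
      - quinticCoeff f g ((a + b) / 2) * (b - a) ^ 5| ≤ C * |b - a| ^ 7 := by
  obtain ⟨Cf, hCf⟩ := exists_taylor_remainder hf K 3
  obtain ⟨Cg, hCg⟩ := exists_taylor_remainder hg K 4
  have hbd (u : ℝ → ℝ) (hu : ContDiff ℝ (⊤ : ℕ∞) u) (k : ℕ) :=
    (isCompact_Icc (a := -K) (b := K)).exists_bound_of_continuousOn
      (hu.continuous_iteratedDeriv k (by exact_mod_cast le_top)).continuousOn
  obtain ⟨F0, hF0⟩ := hbd f hf 0
  obtain ⟨F2, hF2⟩ := hbd f hf 2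
  obtain ⟨G1, hG1⟩ := hbd g hg 1
  obtain ⟨G3, hG3⟩ := hbd g hg 3
  obtain ⟨C, hC⟩ := exists_abs_mul_cube_sub_le
    (|Cf| + 2 * |Cg| + |F0| + |F2| + 2 * |G1| + |G3| + K ^ 2)
  refine ⟨|C|, abs_nonneg C, fun a ha b hb => ?_⟩
  set m := (a + b) / 2 with hm
  set h := (b - a) / 2 with hh
  have hmK : m ∈ Set.Icc (-K) K := ⟨by linarith [ha.1, hb.1], by linarith [ha.2, hb.2]⟩
  obtain ⟨r, hr, hfa⟩ := hCf m hmK a ha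
  obtain ⟨r', hr', hfb⟩ := hCf m hmK b hb
  obtain ⟨s, hs, hga⟩ := hCg m hmK a ha
  obtain ⟨s', hs', hgb⟩ := hCg m hmK b hb
  have ea : a - m = -h := by rw [hm, hh]; ring
  have eb : b - m = h := by rw [hm, hh]; ring
  have eh : b - a = 2 * h := by rw [hh]; ring
  have hf0 := hF0 m hmK
  have hf2 := hF2 m hmK
  have hg1 := hG1 m hmK
  have hg3 := hG3 m hmK
  rw [ea] at hfa hga
  rw [eb] at hfb hgb
  simp only [Finset.sum_range_succ, Finset.sum_range_zero, Nat.factorial, iteratedDeriv_zero,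
    Real.norm_eq_abs] at hfa hfb hga hgb hf0 hf2 hg1 hg3
  have hhK : h ^ 2 ≤ K ^ 2 := sq_le_sq' (by linarith [ha.2, hb.1]) (by linarith [ha.1, hb.2])
  have n1 := abs_nonneg Cf
  have n2 := abs_nonneg Cg
  have n3 := abs_nonneg F0
  have n4 := abs_nonneg F2
  have n5 := abs_nonneg G1
  have n6 := abs_nonneg G3
  have n7 := sq_nonneg K
  have l1 := le_abs_self Cf
  have l2 := le_abs_self Cg
  have l3 := le_abs_self F0
  have l4 := le_abs_self F2
  have l5 := le_abs_self G1
  have l6 := le_abs_self G3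
  have hQ := hC (f m) (iteratedDeriv 2 f m / 2) ((r + r') / 2) (2 * iteratedDeriv 1 g m)
    (iteratedDeriv 3 g m / 3) (s + s') (h ^ 2) (by linarith)
    (by rw [abs_div, abs_two]; linarith [abs_nonneg (iteratedDeriv 2 f m)])
    (by rw [abs_div, abs_two]; linarith [abs_add_le r r'])
    (by rw [abs_mul, abs_two]; linarith)
    (by rw [abs_div, abs_of_pos (three_pos : (0 : ℝ) < 3)]
        linarith [abs_nonneg (iteratedDeriv 3 g m)])
    (by linarith [abs_add_le s s'])
    (by rw [abs_of_nonneg (sq_nonneg h)]; linarith)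
  have key : (f a + f b) / 2 * (g b - g a) ^ 3 - f m * deriv g m ^ 3 * (b - a) ^ 3
      - quinticCoeff f g m * (b - a) ^ 5 = h ^ 3 *
      ((f m + iteratedDeriv 2 f m / 2 * h ^ 2 + (r + r') / 2 * (h ^ 2) ^ 2) *
        (2 * iteratedDeriv 1 g m + iteratedDeriv 3 g m / 3 * h ^ 2 + (s + s') * (h ^ 2) ^ 2) ^ 3
        - f m * (2 * iteratedDeriv 1 g m) ^ 3
        - (3 * f m * (2 * iteratedDeriv 1 g m) ^ 2 * (iteratedDeriv 3 g m / 3)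
          + iteratedDeriv 2 f m / 2 * (2 * iteratedDeriv 1 g m) ^ 3) * h ^ 2) := by
    have e1 : (f a + f b) / 2 = f m + iteratedDeriv 2 f m / 2 * h ^ 2
        + (r + r') / 2 * (h ^ 2) ^ 2 := by
      rw [hfa, hfb]; push_cast; ring
    have e2 : g b - g a = h * (2 * iteratedDeriv 1 g m + iteratedDeriv 3 g m / 3 * h ^ 2
        + (s + s') * (h ^ 2) ^ 2) := by
      rw [hga, hgb]; push_cast; ring
    rw [e1, e2, eh, ← iteratedDeriv_one, quinticCoeff]
    ring
  rw [key, abs_mul, eh, abs_pow]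
  calc |h| ^ 3 * _ ≤ |h| ^ 3 * (|C| * (h ^ 2) ^ 2) := by
        gcongr
        exact hQ.trans (mul_le_mul_of_nonneg_right (le_abs_self C) (by positivity))
    _ = |C| * |h| ^ 7 := by rw [← sq_abs h]; ring
    _ ≤ |C| * |2 * h| ^ 7 := by
        rw [abs_mul, abs_two]
        gcongr
        linarith [abs_nonneg h]

end Taylor

section Localization

lemma exists_bounded_lipschitz_eqOn {φ : ℝ → ℝ} (hφ : ContDiff ℝ 1 φ) {K : ℝ} (hK : 0 ≤ K) :
    ∃ (ψ : ℝ → ℝ) (L M : ℝ), 0 ≤ L ∧ Continuous ψ ∧ (∀ x, |ψ x| ≤ M) ∧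
      (∀ x y, |ψ x - ψ y| ≤ L * |x - y|) ∧ Set.EqOn ψ φ (Set.Icc (-K) K) := by
  have hK' : -K ≤ K := by linarith
  obtain ⟨L, hL⟩ := LocallyLipschitzOn.exists_lipschitzOnWith_of_compact
    (isCompact_Icc (a := -K) (b := K)) hφ.locallyLipschitz.locallyLipschitzOn
  obtain ⟨M, hM⟩ := (isCompact_Icc (a := -K) (b := K)).exists_bound_of_continuousOn
    hφ.continuous.continuousOn
  have hψ : LipschitzWith L fun x => φ (Set.projIcc (-K) K hK' x) := by
    have h := hL.to_restrict.comp (LipschitzWith.projIcc hK')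
    rwa [mul_one] at h
  refine ⟨fun x => φ (Set.projIcc (-K) K hK' x), L, M, L.2, hψ.continuous,
    fun x => hM _ (Set.projIcc (-K) K hK' x).2, fun x y => ?_, fun x hx => ?_⟩
  · simpa [Real.dist_eq] using hψ.dist_le_mul x y
  · simp [Set.projIcc_of_mem hK' hx]

/-- The event that `|B|` is bounded by `K` at the rational points of `[0, T]`. -/
def boundedEvent {Ω : Type*} (B : ℝ → Ω → ℝ) (T K : ℝ) : Set Ω :=
  {ω | ∀ q : ℚ, 0 ≤ (q : ℝ) → (q : ℝ) ≤ T → |B q ω| ≤ K}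

lemma IsFBM16.exists_measure_compl_boundedEvent_le {Ω : Type*} [MeasureSpace Ω]
    [IsProbabilityMeasure (volume : Measure Ω)] {B : ℝ → Ω → ℝ} (hB : IsFBM16 B) (T : ℝ)
    {η : ENNReal} (hη : 0 < η) : ∃ K : ℕ, volume (boundedEvent B T K)ᶜ ≤ η := by
  have hmeas (K : ℕ) : MeasurableSet (boundedEvent B T K) := by
    simp only [boundedEvent, Set.ofPred_forall]
    exact .iInter fun q => .iInter fun _ => .iInter fun _ =>
      measurableSet_le (hB.1 q).abs measurable_const
  have hanti : Antitone fun K : ℕ => (boundedEvent B T K)ᶜ := fun K K' h =>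
    Set.compl_subset_compl.2 fun ω hω q h0 hT => (hω q h0 hT).trans (by exact_mod_cast h)
  have hempty : ⋂ K : ℕ, (boundedEvent B T K)ᶜ = ∅ := by
    rw [← Set.compl_iUnion, Set.compl_empty_iff, Set.eq_univ_iff_forall]
    intro ω
    obtain ⟨C, hC⟩ := (isCompact_Icc (a := (0 : ℝ)) (b := T)).exists_bound_of_continuousOn
      (hB.2.1 ω).continuousOn
    obtain ⟨K, hK⟩ := exists_nat_ge C
    exact Set.mem_iUnion.2 ⟨K, fun q h0 hT => (hC q ⟨h0, hT⟩).trans hK⟩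
  have h := tendsto_measure_iInter_atTop (μ := volume)
    (fun K => (hmeas K).compl.nullMeasurableSet) hanti ⟨0, measure_ne_top _ _⟩
  rw [hempty, measure_empty] at h
  exact (ENNReal.tendsto_nhds_zero.1 h η hη).exists

lemma mem_Icc_of_mem_boundedEvent {Ω : Type*} {B : ℝ → Ω → ℝ} {T K : ℝ} {ω : Ω}
    (hω : ω ∈ boundedEvent B T K) {n j : ℕ} (h : (j : ℝ) ≤ n * T) (hn : 0 < n) :
    B ((j : ℝ) / n) ω ∈ Set.Icc (-K) K := by
  have h1 := hω ((j : ℚ) / n) (by positivity)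
    (by push_cast; rwa [div_le_iff₀' (by exact_mod_cast hn)])
  push_cast at h1
  exact abs_le.1 h1

end Localization

namespace IsFBM16

variable {Ω : Type*} [MeasureSpace Ω] [IsProbabilityMeasure (volume : Measure Ω)]
  {B : ℝ → Ω → ℝ}

lemma measureReal_sum_abs_pow_ge_le (hB : IsFBM16 B) {n : ℕ} (hn : 0 < n) {s : Finset ℕ}
    (hs : ∀ j ∈ s, 1 ≤ j) (p r : ℕ) {c : ℝ} (hc : 0 < c) :
    volume.real {ω | c ≤ ∑ j ∈ s, |meshInc B n j ω| ^ p} ≤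
      (s.card : ℝ) ^ (r + 1) * (absMoment (p * (r + 1)) * incScale n ^ (p * (r + 1)))
        / c ^ (r + 1) := by
  rw [le_div_iff₀' (by positivity)]
  have hint : ∀ j ∈ s, Integrable fun ω => |meshInc B n j ω| ^ (p * (r + 1)) := fun j hj =>
    integrable_abs_pow (hB.hasGaussianLaw_meshInc n (hs j hj)) _
  calc c ^ (r + 1) * volume.real {ω | c ≤ ∑ j ∈ s, |meshInc B n j ω| ^ p}
      ≤ c ^ (r + 1) * volume.real {ω | c ^ (r + 1) ≤
          (s.card : ℝ) ^ r * ∑ j ∈ s, |meshInc B n j ω| ^ (p * (r + 1))} := by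
        refine mul_le_mul_of_nonneg_left (measureReal_mono fun ω hω => ?_) (by positivity)
        have h1 := pow_sum_div_card_le_sum_pow (s := s) (f := fun j => |meshInc B n j ω| ^ p)
          (fun j _ => by positivity) r
        have h2 : 0 < s.card := by
          refine Finset.card_pos.2 (Finset.nonempty_of_sum_ne_zero (hc.trans_le hω).ne')
        rw [div_le_iff₀' (by positivity)] at h1
        simp_rw [← pow_mul] at h1
        exact (pow_le_pow_left₀ hc.le hω _).trans h1
    _ ≤ ∫ ω, (s.card : ℝ) ^ r * ∑ j ∈ s, |meshInc B n j ω| ^ (p * (r + 1)) :=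
        mul_meas_ge_le_integral_of_nonneg (ae_of_all _ fun ω => by positivity)
          ((integrable_finsetSum _ hint).const_mul _) _
    _ = _ := by
        rw [integral_const_mul, integral_finsetSum _ hint,
          Finset.sum_congr rfl fun j hj => hB.integral_abs_meshInc_pow hn (hs j hj) _,
          Finset.sum_const, nsmul_eq_mul]
        ring

variable {φ : ℝ → ℝ} {M L : ℝ}

lemma measureReal_abs_sum_ge_le (hB : IsFBM16 B) (hφ : Continuous φ) (hM : ∀ x, |φ x| ≤ M)
    (hL0 : 0 ≤ L) (hL : ∀ x y, |φ x - φ y| ≤ L * |x - y|) {n : ℕ} (hn : 0 < n) (k : ℕ) {c : ℝ}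
    (hc : 0 < c) :
    volume.real {ω | c ≤ |∑ j ∈ Finset.Icc 1 k, φ (meshMid B n j ω) * meshInc B n j ω ^ 5|} ≤
      5 * (k * (k : ℝ) ^ ((1 : ℝ) / 3)) * (decorConst L M * incScale n ^ 10) / c ^ 2 := by
  rw [le_div_iff₀' (by positivity)]
  refine le_trans ?_ (hB.integral_sum_sq_le hφ hM hL0 hL hn k)
  refine le_trans ?_ (mul_meas_ge_le_integral_of_nonneg (ae_of_all _ fun ω => sq_nonneg _)
    (hB.integrable_sum_sq hφ hM n k) (c ^ 2))
  refine mul_le_mul_of_nonneg_left (measureReal_mono fun ω hω => ?_) (by positivity)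
  exact (pow_le_pow_left₀ hc.le hω 2).trans_eq (sq_abs _)

end IsFBM16

lemma abs_sum_Icc_le_grid {a b : ℕ → ℝ} {M : ℝ} (hM : 0 ≤ M) (hb : ∀ j, 0 ≤ b j)
    (hab : ∀ j, |a j| ≤ M * b j) {m : ℕ} (hm : 0 < m) (k : ℕ) :
    |∑ j ∈ Finset.Icc 1 k, a j| ≤ |∑ j ∈ Finset.Icc 1 (m * (k / m)), a j|
      + M * ∑ j ∈ Finset.Ioc (m * (k / m)) (m * (k / m) + m), b j := by
  have h (l : ℕ) : Finset.Icc 1 l = Finset.Ioc 0 l := rfl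
  rw [h, h, ← Finset.sum_Ioc_consecutive a (Nat.zero_le _) (Nat.mul_div_le k m)]
  refine (abs_add_le _ _).trans (add_le_add_right ?_ _)
  calc |∑ j ∈ Finset.Ioc (m * (k / m)) k, a j|
      ≤ ∑ j ∈ Finset.Ioc (m * (k / m)) k, M * b j :=
        (Finset.abs_sum_le_sum_abs _ _).trans (Finset.sum_le_sum fun j _ => hab j)
    _ ≤ ∑ j ∈ Finset.Ioc (m * (k / m)) (m * (k / m) + m), M * b j := by
        refine Finset.sum_le_sum_of_subset_of_nonneg (Finset.Ioc_subset_Ioc_right ?_)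
          fun j _ _ => mul_nonneg hM (hb j)
        have := Nat.lt_mul_div_succ k hm
        rw [mul_add_one] at this
        exact this.le
    _ = _ := by rw [Finset.mul_sum]

namespace IsFBM16

variable {Ω : Type*} [MeasureSpace Ω] [IsProbabilityMeasure (volume : Measure Ω)]
  {B : ℝ → Ω → ℝ} {φ : ℝ → ℝ} {M L : ℝ}

lemma exists_uniform_sum_bound (hB : IsFBM16 B) (hφ : Continuous φ) (hM : ∀ x, |φ x| ≤ M)
    (hL0 : 0 ≤ L) (hL : ∀ x y, |φ x - φ y| ≤ L * |x - y|) {T c : ℝ} (hT : 0 < T) (hc : 0 < c) :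
    ∃ A : ℝ, ∀ n : ℕ, 0 < n → ∃ E : Set Ω, volume.real E ≤ A * ((n : ℝ) ^ (1 / 12 : ℝ))⁻¹ ∧
      ∀ ω ∉ E, ∑ j ∈ Finset.Icc 1 ⌊n * T⌋₊, |meshInc B n j ω| ^ 7 ≤ c ∧
        ∀ k ≤ ⌊n * T⌋₊,
          |∑ j ∈ Finset.Icc 1 k, φ (meshMid B n j ω) * meshInc B n j ω ^ 5| ≤ c + M * c := by
  have hM0 : 0 ≤ M := (abs_nonneg _).trans (hM 0)
  have hD := decorConst_nonneg hL0 hM0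
  have hm20 := absMoment_nonneg 20
  have hm7 := absMoment_nonneg 7
  set A₁ := 5 * (T * T ^ ((1 : ℝ) / 3)) * decorConst L M / c ^ 2 with hA₁
  set A₂ := 16 * absMoment 20 / c ^ 4 with hA₂
  set A₃ := T * absMoment 7 / c with hA₃
  have hA₁0 : 0 ≤ A₁ := by positivity
  have hA₂0 : 0 ≤ A₂ := by positivity
  have hA₃0 : 0 ≤ A₃ := by positivity
  refine ⟨(T + 1) * (A₁ + A₂) + A₃, fun n hn => ?_⟩
  set z := (n : ℝ) ^ (1 / 12 : ℝ) with hz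
  have hz1 : 1 ≤ z := Real.one_le_rpow (by exact_mod_cast hn) (by norm_num)
  have hz0 : 0 < z := by positivity
  have hzn : z ^ 12 = n := by
    rw [hz, ← Real.rpow_natCast, ← Real.rpow_mul n.cast_nonneg]
    norm_num
  set w := z⁻¹ with hw
  have hw0 : 0 < w := inv_pos.2 hz0
  have hw1 : w ≤ 1 := inv_le_one_of_one_le₀ hz1
  have hzw : z * w = 1 := mul_inv_cancel₀ hz0.ne'
  have hscale : incScale n = w ^ 2 := by
    rw [hw, hz, ← Real.rpow_neg n.cast_nonneg, ← Real.rpow_natCast,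
      ← Real.rpow_mul n.cast_nonneg, incScale]
    norm_num
  set N := ⌊n * T⌋₊ with hN
  have hNle : (N : ℝ) ≤ T * z ^ 12 := by
    rw [hzn, mul_comm]
    exact Nat.floor_le (by positivity)
  set m := ⌈z ^ 9⌉₊ with hm
  have hm_ge : z ^ 9 ≤ m := Nat.le_ceil _
  have hm_le : (m : ℝ) ≤ 2 * z ^ 9 := by
    have h1 := (Nat.ceil_lt_add_one (pow_nonneg hz0.le 9)).le
    have h2 := one_le_pow₀ hz1 (n := 9)
    linarith
  have hm0 : 0 < m := Nat.ceil_pos.2 (by positivity)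
  have hQ : ((N / m + 1 : ℕ) : ℝ) ≤ (T + 1) * z ^ 3 := by
    have h1 : ((N / m : ℕ) : ℝ) ≤ T * z ^ 3 := by
      refine Nat.cast_div_le.trans ?_
      rw [div_le_iff₀ (by exact_mod_cast hm0)]
      calc (N : ℝ) ≤ T * z ^ 3 * z ^ 9 := by rw [mul_assoc, ← pow_add]; exact hNle
        _ ≤ T * z ^ 3 * m := by gcongr
    have h2 := one_le_pow₀ hz1 (n := 3)
    push_cast
    linarith
  set E₁ : ℕ → Set Ω := fun q =>
    {ω | c ≤ |∑ j ∈ Finset.Icc 1 (m * q), φ (meshMid B n j ω) * meshInc B n j ω ^ 5|}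
  set E₂ : ℕ → Set Ω := fun q =>
    {ω | c ≤ ∑ j ∈ Finset.Ioc (m * q) (m * q + m), |meshInc B n j ω| ^ 5}
  set E₃ : Set Ω := {ω | c ≤ ∑ j ∈ Finset.Icc 1 N, |meshInc B n j ω| ^ 7}
  have b₁ : ∀ q ∈ Finset.range (N / m + 1), volume.real (E₁ q) ≤ A₁ * w ^ 4 := fun q hq => by
    have hk : ((m * q : ℕ) : ℝ) ≤ T * z ^ 12 := by
      refine le_trans ?_ hNle
      exact_mod_cast (Nat.mul_le_mul_left m (Finset.mem_range_succ_iff.1 hq)).trans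
        (Nat.mul_div_le N m)
    have hk3 : ((m * q : ℕ) : ℝ) ^ ((1 : ℝ) / 3) ≤ T ^ ((1 : ℝ) / 3) * z ^ 4 := by
      refine (Real.rpow_le_rpow (Nat.cast_nonneg _) hk (by norm_num)).trans_eq ?_
      rw [Real.mul_rpow hT.le (by positivity), ← Real.rpow_natCast, ← Real.rpow_mul hz0.le]
      norm_num
    calc volume.real (E₁ q) ≤ _ := hB.measureReal_abs_sum_ge_le hφ hM hL0 hL hn (m * q) hc
      _ ≤ 5 * (T * z ^ 12 * (T ^ ((1 : ℝ) / 3) * z ^ 4)) * (decorConst L M * incScale n ^ 10)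
          / c ^ 2 := by
        rw [hscale]
        gcongr
      _ = A₁ * ((z * w) ^ 16 * w ^ 4) := by
        rw [hscale, hA₁]
        ring
      _ = A₁ * w ^ 4 := by rw [hzw]; ring
  have b₂ (q : ℕ) : volume.real (E₂ q) ≤ A₂ * w ^ 4 := by
    refine (hB.measureReal_sum_abs_pow_ge_le hn (s := Finset.Ioc (m * q) (m * q + m))
      (fun j hj => Nat.one_le_of_lt (Finset.mem_Ioc.1 hj).1) 5 3 hc).trans ?_
    rw [Nat.card_Ioc, add_tsub_cancel_left, hscale]
    norm_num only
    calc (m : ℝ) ^ 4 * (absMoment 20 * (w ^ 2) ^ 20) / c ^ 4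
        ≤ (2 * z ^ 9) ^ 4 * (absMoment 20 * (w ^ 2) ^ 20) / c ^ 4 := by gcongr
      _ = A₂ * ((z * w) ^ 36 * w ^ 4) := by
        rw [hA₂]
        ring
      _ = A₂ * w ^ 4 := by rw [hzw]; ring
  have b₃ : volume.real E₃ ≤ A₃ * w := by
    refine (hB.measureReal_sum_abs_pow_ge_le hn (s := Finset.Icc 1 N)
      (fun j hj => (Finset.mem_Icc.1 hj).1) 7 0 hc).trans ?_
    rw [Nat.card_Icc, add_tsub_cancel_right, hscale]
    norm_num only
    calc (N : ℝ) ^ 1 * (absMoment 7 * (w ^ 2) ^ 7) / c ^ 1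
        ≤ (T * z ^ 12) ^ 1 * (absMoment 7 * (w ^ 2) ^ 7) / c ^ 1 := by gcongr
      _ = A₃ * ((z * w) ^ 12 * w) * w := by
        rw [hA₃]
        ring
      _ ≤ A₃ * w := by
        rw [hzw, one_pow, one_mul, mul_assoc]
        gcongr
        exact mul_le_of_le_one_left hw0.le hw1
  refine ⟨(⋃ q ∈ Finset.range (N / m + 1), E₁ q ∪ E₂ q) ∪ E₃, ?_, fun ω hω => ?_⟩
  · calc volume.real ((⋃ q ∈ Finset.range (N / m + 1), E₁ q ∪ E₂ q) ∪ E₃)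
        ≤ ∑ q ∈ Finset.range (N / m + 1), (A₁ * w ^ 4 + A₂ * w ^ 4) + A₃ * w := by
          refine (measureReal_union_le _ _).trans (add_le_add ?_ b₃)
          refine (measureReal_biUnion_finset_le _ _).trans (Finset.sum_le_sum fun q hq => ?_)
          exact (measureReal_union_le _ _).trans (add_le_add (b₁ q hq) (b₂ q))
      _ ≤ (T + 1) * z ^ 3 * (A₁ * w ^ 4 + A₂ * w ^ 4) + A₃ * w := by
          rw [Finset.sum_const, Finset.card_range, nsmul_eq_mul]
          gcongr
      _ = ((z * w) ^ 3 * ((T + 1) * (A₁ + A₂)) + A₃) * w := by ring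
      _ = _ := by rw [hzw, one_pow, one_mul]
  · simp only [Set.mem_union, Set.mem_iUnion, not_or, not_exists] at hω
    refine ⟨(not_le.1 hω.2).le, fun k hk => ?_⟩
    obtain ⟨h1, h2⟩ := hω.1 (k / m) (Finset.mem_range_succ_iff.2 (Nat.div_le_div_right hk))
    refine (abs_sum_Icc_le_grid hM0 (b := fun j => |meshInc B n j ω| ^ 5)
      (fun j => by positivity) (fun j => ?_) hm0 k).trans ?_
    · rw [abs_mul, abs_pow]
      gcongr
      exact hM _
    · exact add_le_add (not_le.1 h1).le (mul_le_mul_of_nonneg_left (not_le.1 h2).le hM0)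

end IsFBM16

lemma abs_sum_trapezoid_sub_le {Ω : Type*} {B : ℝ → Ω → ℝ} {f g ψ : ℝ → ℝ} {T K C : ℝ} {ω : Ω}
    (hω : ω ∈ boundedEvent B T K) (hψ : Set.EqOn ψ (quinticCoeff f g) (Set.Icc (-K) K))
    (hC : ∀ a ∈ Set.Icc (-K) K, ∀ b ∈ Set.Icc (-K) K,
      |(f a + f b) / 2 * (g b - g a) ^ 3 - f ((a + b) / 2) * deriv g ((a + b) / 2) ^ 3 * (b - a) ^ 3
        - quinticCoeff f g ((a + b) / 2) * (b - a) ^ 5| ≤ C * |b - a| ^ 7)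
    {n k : ℕ} (hn : 0 < n) (hk : (k : ℝ) ≤ n * T) :
    |(∑ j ∈ Finset.Icc 1 k,
          ((f (B (((j : ℝ) - 1) / n) ω) + f (B ((j : ℝ) / n) ω)) / 2) *
            (g (B ((j : ℝ) / n) ω) - g (B (((j : ℝ) - 1) / n) ω)) ^ 3)
        - ∑ j ∈ Finset.Icc 1 k,
            f ((B (((j : ℝ) - 1) / n) ω + B ((j : ℝ) / n) ω) / 2) *
              (deriv g ((B (((j : ℝ) - 1) / n) ω + B ((j : ℝ) / n) ω) / 2)) ^ 3 *
              (B ((j : ℝ) / n) ω - B (((j : ℝ) - 1) / n) ω) ^ 3| ≤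
      |∑ j ∈ Finset.Icc 1 k, ψ (meshMid B n j ω) * meshInc B n j ω ^ 5|
        + C * ∑ j ∈ Finset.Icc 1 k, |meshInc B n j ω| ^ 7 := by
  rw [← sub_le_iff_le_add', ← Finset.sum_sub_distrib, Finset.mul_sum]
  refine (abs_sub_abs_le_abs_sub _ _).trans ?_
  rw [← Finset.sum_sub_distrib]
  refine (Finset.abs_sum_le_sum_abs _ _).trans (Finset.sum_le_sum fun j hj => ?_)
  obtain ⟨hj1, hjk⟩ := Finset.mem_Icc.1 hj
  have hj : (j : ℝ) ≤ n * T := le_trans (by exact_mod_cast hjk) hk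
  have hb := mem_Icc_of_mem_boundedEvent hω hj hn
  have ha := mem_Icc_of_mem_boundedEvent hω (j := j - 1)
    (by push_cast [Nat.cast_sub hj1]; linarith) hn
  rw [Nat.cast_sub hj1, Nat.cast_one] at ha
  rw [hψ (show meshMid B n j ω ∈ Set.Icc (-K) K from
    ⟨by unfold meshMid; linarith [ha.1, hb.1], by unfold meshMid; linarith [ha.2, hb.2]⟩)]
  exact hC _ ha _ hb

/-- Identification of `∫ X d⟦Y⟧` with `∫ f(B) (g'(B))³ d⟦B⟧` for `X = f(B)`, `Y = g(B)`,
at the level of Riemann-sum representatives. -/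
theorem stmt19 {Ω : Type*} [MeasureSpace Ω] [IsProbabilityMeasure (volume : Measure Ω)]
    (B : ℝ → Ω → ℝ) (hB : IsFBM16 B)
    (f g : ℝ → ℝ) (hf : ContDiff ℝ (⊤ : ℕ∞) f) (hg : ContDiff ℝ (⊤ : ℕ∞) g) :
    ∀ T > (0 : ℝ), ∀ ε > (0 : ℝ),
      Tendsto (fun n : ℕ =>
          volume {ω : Ω | ε ≤
            ⨆ t ∈ Set.Icc (0 : ℝ) T,
              |(∑ j ∈ Finset.Icc 1 ⌊(n : ℝ) * t⌋₊,
                  ((f (B (((j : ℝ) - 1) / n) ω) + f (B ((j : ℝ) / n) ω)) / 2) *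
                    (g (B ((j : ℝ) / n) ω) - g (B (((j : ℝ) - 1) / n) ω)) ^ 3)
                - ∑ j ∈ Finset.Icc 1 ⌊(n : ℝ) * t⌋₊,
                    f ((B (((j : ℝ) - 1) / n) ω + B ((j : ℝ) / n) ω) / 2) *
                      (deriv g ((B (((j : ℝ) - 1) / n) ω + B ((j : ℝ) / n) ω) / 2)) ^ 3 *
                      (B ((j : ℝ) / n) ω - B (((j : ℝ) - 1) / n) ω) ^ 3|})
        atTop (𝓝 0) := by
  intro T hT ε hε
  rw [ENNReal.tendsto_nhds_zero]
  intro η hη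
  have hη2 : 0 < η / 2 := ENNReal.half_pos hη.ne'
  obtain ⟨K, hK⟩ := hB.exists_measure_compl_boundedEvent_le T hη2
  obtain ⟨ψ, L, M, hL0, hψc, hM, hL, hψ⟩ :=
    exists_bounded_lipschitz_eqOn (contDiff_quinticCoeff hf hg) K.cast_nonneg
  obtain ⟨C, hC0, hC⟩ := exists_abs_trapezoid_mul_cube_sub_le hf hg K
  have hM0 : 0 ≤ M := (abs_nonneg _).trans (hM 0)
  set c := ε / (2 * (1 + M + C)) with hc
  have hc0 : 0 < c := by positivity
  have hcε : c + M * c + C * c = ε / 2 := by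
    rw [hc]
    field_simp
  obtain ⟨A, hA⟩ := hB.exists_uniform_sum_bound hψc hM hL0 hL hT hc0
  have hlim : Tendsto (fun n : ℕ => ENNReal.ofReal (A * ((n : ℝ) ^ (1 / 12 : ℝ))⁻¹)) atTop
      (𝓝 0) := by
    have h := ((tendsto_rpow_atTop (y := 1 / 12) (by norm_num)).comp
      tendsto_natCast_atTop_atTop).inv_tendsto_atTop.const_mul A
    simpa using (ENNReal.tendsto_ofReal h)
  filter_upwards [ENNReal.tendsto_nhds_zero.1 hlim _ hη2, eventually_gt_atTop 0] with n hn hn0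
  obtain ⟨E, hE, hEb⟩ := hA n hn0
  calc _ ≤ volume ((boundedEvent B T K)ᶜ ∪ E) := by
        refine measure_mono fun ω hω => ?_
        by_contra hω'
        rw [Set.mem_union, not_or, Set.mem_compl_iff, not_not] at hω'
        obtain ⟨h7, h5⟩ := hEb ω hω'.2
        refine (half_lt_self hε).not_ge (le_trans hω ?_)
        refine Real.iSup_le (fun t => Real.iSup_le (fun ht => ?_) (by positivity)) (by positivity)
        have hk : ⌊(n : ℝ) * t⌋₊ ≤ ⌊(n : ℝ) * T⌋₊ := by
          gcongr
          exact ht.2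
        refine (abs_sum_trapezoid_sub_le hω'.1 hψ hC hn0
          ((Nat.cast_le.2 hk).trans (Nat.floor_le (by positivity)))).trans ?_
        rw [← hcε]
        refine add_le_add (h5 _ hk) (mul_le_mul_of_nonneg_left (le_trans ?_ h7) hC0)
        exact Finset.sum_le_sum_of_subset_of_nonneg (Finset.Icc_subset_Icc_right hk)
          fun j _ _ => by positivity
    _ ≤ η / 2 + η / 2 := by
        refine (measure_union_le _ _).trans (add_le_add hK (le_trans ?_ hn))
        rw [← ofReal_measureReal]
        exact ENNReal.ofReal_le_ofReal hE
    _ = η := ENNReal.add_halves η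
end
end
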